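/- arXiv:1801.05562 — 3 statements merged into one kernel-verified Lean document; each statement's English description precedes it below -/
import Mathlib

section
/- There exist absolute constants c₁, c₂ > 0 such that for every totally real number field F and every CM extension K/F with ζ_K(1/2) ≤ ρ_F/(4·[O_K^×:O_F^×]·h_F) · log(√D_K/D_F), one has h_K^− ≥ c₁ · D_F^{−c₂} · D_K^{1/4} · log D_{K/F}, where h_K^− = h_K/h_F is the relative class number of K/F and D_{K/F} = D_K·D_F^{−2}. -/
open NumberField Filter Topology
open scoped NumberField ComplexOrder nonZeroDivisors

/-- The Dedekind zeta Dirichlet series of a number field, real variable version. -/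
noncomputable def zetaSeries (L : Type) [Field L] [NumberField L] (s : ℝ) : ℝ :=
  ∑' I : (Ideal (𝓞 L))⁰, (Ideal.absNorm (I : Ideal (𝓞 L)) : ℝ) ^ (-s)

/-- The Dedekind zeta Dirichlet series, complex variable version. -/
noncomputable def zetaSeriesC (L : Type) [Field L] [NumberField L] (s : ℂ) : ℂ :=
  ∑' I : (Ideal (𝓞 L))⁰, (Ideal.absNorm (I : Ideal (𝓞 L)) : ℂ) ^ (-s)

/-- The index `[𝓞_K^× : 𝓞_F^×]`. -/
noncomputable def unitIndex (F K : Type) [Field F] [NumberField F] [Field K] [NumberField K]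
    [Algebra F K] : ℕ :=
  (MonoidHom.range (Units.map (algebraMap (𝓞 F) (𝓞 K)).toMonoidHom)).index

section Auxiliary

open MeasureTheory
open scoped ENNReal

/-- The weight `exp (-t)` as an extended nonnegative real. -/
noncomputable def expNeg (t : ℝ) : ℝ≥0∞ := ENNReal.ofReal (Real.exp (-t))

theorem expNeg_add (s t : ℝ) : expNeg (s + t) = expNeg s * expNeg t := by
  rw [expNeg, neg_add, Real.exp_add, ENNReal.ofReal_mul (Real.exp_nonneg _)]; rfl

theorem measurable_expNeg : Measurable expNeg := by
  unfold expNeg; fun_prop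

section Lattice

variable {V : Type*} [AddCommGroup V] [MeasurableSpace V] [MeasurableAdd₂ V] {μ : Measure V}
  {Λ : Submodule ℤ V} [Countable Λ] [MeasurableConstVAdd Λ V]
  [VAddInvariantMeasure Λ V μ] {D : Set V}

theorem tsum_lattice_le (hD : IsAddFundamentalDomain Λ D μ) {q : V → ℝ}
    (hq : Measurable q) {B η : ℝ} (hη : ∀ u, ∀ x ∈ D, (1 - η) * q u ≤ q (u - x) + B) :
    μ D * (∑' v : Λ, expNeg (q v)) ≤ expNeg (-B) * ∫⁻ x, expNeg ((1 - η) * q x) ∂μ := by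
  have hm (v : Λ) : Measurable fun x : V ↦ expNeg ((1 - η : ℝ) * q (v +ᵥ x)) := by
    refine measurable_expNeg.comp ((hq.comp ?_).const_mul _)
    exact measurable_const_add (v : V)
  rw [hD.lintegral_eq_tsum'', ← ENNReal.tsum_mul_left, ← ENNReal.tsum_mul_left]
  refine ENNReal.tsum_le_tsum fun v ↦ ?_
  rw [← lintegral_const_mul _ (hm v), mul_comm, ← setLIntegral_const]
  refine setLIntegral_mono_ae ((hm v).const_mul _).aemeasurable (ae_of_all _ fun x hx ↦ ?_)
  rw [← expNeg_add]
  refine ENNReal.ofReal_le_ofReal (Real.exp_le_exp.mpr ?_)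
  have := hη (v +ᵥ x) x hx
  have hv : (v +ᵥ x) - x = (v : V) := by simp [Submodule.vadd_def]
  rw [hv] at this
  linarith

variable [Module ℝ V] [MeasurableConstSMul ℝ V] [μ.IsAddLeftInvariant]

theorem sq_lintegral_le_tsum_lattice (hD : IsAddFundamentalDomain Λ D μ) {q : V → ℝ}
    (hq : Measurable q) (hpar : ∀ x y, 2 * q x + 2 * q y = q (x + y) + q (y - x)) :
    (∫⁻ x, expNeg (2 * q x) ∂μ) ^ 2 ≤
      μ D * ((∑' v : Λ, expNeg (q v)) * ∫⁻ x, expNeg (q ((2 : ℝ) • x)) ∂μ) := by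
  set Φ : V → ℝ≥0∞ := fun x ↦ ∑' v : Λ, expNeg (2 * q (v +ᵥ x)) with hΦ
  have hm (v : Λ) : Measurable fun x : V ↦ expNeg (2 * q (v +ᵥ x)) := by
    refine measurable_expNeg.comp ((hq.comp ?_).const_mul 2)
    exact measurable_const_add (v : V)
  have hΦm : Measurable Φ := Measurable.tsum hm
  have h1 : ∫⁻ x, expNeg (2 * q x) ∂μ = ∫⁻ x in D, Φ x ∂μ := by
    rw [hD.lintegral_eq_tsum'', lintegral_tsum fun v ↦ (hm v).aemeasurable]
  have h2 : ∫⁻ x in D, Φ x ^ 2 ∂μ =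
      (∑' v : Λ, expNeg (q v)) * ∫⁻ x, expNeg (q ((2 : ℝ) • x)) ∂μ := by
    have hmv (ν : Λ) : Measurable fun x ↦ expNeg (q ((2 : ℝ) • x + ν)) :=
      measurable_expNeg.comp (hq.comp ((measurable_const_smul _).add_const _))
    have hsq (x : V) : Φ x ^ 2 =
        ∑' ν : Λ, ∑' v : Λ, expNeg (q ν) * expNeg (q ((2 : ℝ) • (v +ᵥ x) + ν)) := by
      rw [ENNReal.tsum_comm, sq, hΦ, ← ENNReal.tsum_mul_right]
      refine tsum_congr fun v ↦ ?_
      rw [← ENNReal.tsum_mul_left, ← (Equiv.addLeft v).tsum_eq]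
      refine tsum_congr fun ν ↦ ?_
      rw [← expNeg_add, ← expNeg_add, hpar]
      congr 1
      rw [add_comm]
      congr 2
      · simp only [Equiv.coe_addLeft, Submodule.vadd_def, vadd_eq_add, Submodule.coe_add]
        abel
      · simp only [Equiv.coe_addLeft, Submodule.vadd_def, vadd_eq_add, Submodule.coe_add, two_smul]
        abel
    simp_rw [hsq]
    rw [lintegral_tsum (β := Λ) fun ν ↦ ?_]
    swap
    · refine (Measurable.tsum fun v ↦ ?_).aemeasurable
      exact ((hmv ν).comp (measurable_const_add (v : V))).const_mul _
    rw [← ENNReal.tsum_mul_right]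
    refine tsum_congr fun ν ↦ ?_
    simp_rw [ENNReal.tsum_mul_left]
    rw [lintegral_const_mul]
    swap
    · exact Measurable.tsum fun v ↦ (hmv ν).comp (measurable_const_add (v : V))
    congr 1
    have hmv' (v : Λ) : Measurable fun x : V ↦ expNeg (q ((2 : ℝ) • (v +ᵥ x) + ν)) :=
      (hmv ν).comp (measurable_const_add (v : V))
    rw [lintegral_tsum fun v ↦ (hmv' v).aemeasurable,
      ← hD.lintegral_eq_tsum'' fun x ↦ expNeg (q ((2 : ℝ) • x + ν)),
      ← lintegral_add_left_eq_self _ (-((2 : ℝ)⁻¹ • (ν : V)))]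
    refine lintegral_congr fun x ↦ ?_
    rw [smul_add, smul_neg, smul_smul]
    norm_num
  rw [h1, ← h2]
  have hcs := ENNReal.lintegral_mul_le_Lp_mul_Lq (μ.restrict D) Real.HolderConjugate.two_two
    (measurable_const (a := (1 : ℝ≥0∞))).aemeasurable hΦm.aemeasurable
  simp only [Pi.mul_apply, one_mul, ENNReal.one_rpow, lintegral_const, Measure.restrict_apply,
    MeasurableSet.univ, Set.univ_inter] at hcs
  calc (∫⁻ x in D, Φ x ∂μ) ^ 2
      ≤ ((μ D) ^ (1 / 2 : ℝ) * (∫⁻ x in D, Φ x ^ (2 : ℝ) ∂μ) ^ (1 / 2 : ℝ)) ^ 2 := by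
        gcongr
    _ = _ := by
      rw [mul_pow, ← ENNReal.rpow_natCast, ← ENNReal.rpow_mul, ← ENNReal.rpow_natCast,
        ← ENNReal.rpow_mul]
      norm_num

end Lattice

section Theta

variable (L : Type*) [Field L] [NumberField L]

open NumberField.InfinitePlace NumberField.mixedEmbedding

variable {L} in
/-- The diagonal quadratic form on the mixed space with coefficients `a`. -/
noncomputable def placeForm (a : InfinitePlace L → ℝ) (x : mixedSpace L) : ℝ :=
  ∑ w, a w * normAtPlace w x ^ 2

variable {L} in
/-- The value of the Gaussian integral attached to `placeForm a`. -/
noncomputable def gaussVol (a : InfinitePlace L → ℝ) : ℝ :=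
  ∏ w, (Real.pi / a w) ^ ((w.mult : ℝ) / 2)

variable {L}

theorem continuous_placeForm (a : InfinitePlace L → ℝ) : Continuous (placeForm a) := by
  unfold placeForm
  exact continuous_finsetSum _ fun w _ ↦ ((continuous_normAtPlace w).pow 2).const_mul _

theorem placeForm_const_mul (c : ℝ) (a : InfinitePlace L → ℝ) (x : mixedSpace L) :
    placeForm (fun w ↦ c * a w) x = c * placeForm a x := by
  simp only [placeForm, Finset.mul_sum, mul_assoc]

theorem placeForm_smul (c : ℝ) (a : InfinitePlace L → ℝ) (x : mixedSpace L) :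
    placeForm a (c • x) = c ^ 2 * placeForm a x := by
  simp only [placeForm, Finset.mul_sum, normAtPlace_smul, mul_pow, sq_abs]
  exact Finset.sum_congr rfl fun w _ ↦ by ring

theorem normAtPlace_parallelogram {L : Type*} [Field L] (w : InfinitePlace L) (x y : mixedSpace L) :
    2 * normAtPlace w x ^ 2 + 2 * normAtPlace w y ^ 2 =
      normAtPlace w (x + y) ^ 2 + normAtPlace w (y - x) ^ 2 := by
  rcases w.isReal_or_isComplex with hw | hw
  · simp only [normAtPlace_apply_of_isReal hw, Prod.fst_add, Prod.fst_sub, Pi.add_apply,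
      Pi.sub_apply, Real.norm_eq_abs, sq_abs]
    ring
  · simp only [normAtPlace_apply_of_isComplex hw, Prod.snd_add, Prod.snd_sub, Pi.add_apply,
      Pi.sub_apply]
    have := parallelogram_law_with_norm ℝ (x.2 ⟨w, hw⟩) (y.2 ⟨w, hw⟩)
    rw [norm_sub_rev] at this
    linarith

theorem placeForm_parallelogram (a : InfinitePlace L → ℝ) (x y : mixedSpace L) :
    2 * placeForm a x + 2 * placeForm a y = placeForm a (x + y) + placeForm a (y - x) := by
  simp only [placeForm, Finset.mul_sum, ← Finset.sum_add_distrib]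
  refine Finset.sum_congr rfl fun w _ ↦ ?_
  linear_combination a w * normAtPlace_parallelogram w x y

theorem placeForm_sub_le {a : InfinitePlace L → ℝ} (ha : ∀ w, 0 ≤ a w) {η : ℝ} (hη : 0 < η)
    (u x : mixedSpace L) :
    (1 - η) * placeForm a u ≤ placeForm a (u - x) + placeForm a x / η := by
  simp only [placeForm, Finset.mul_sum, Finset.sum_div, ← Finset.sum_add_distrib]
  refine Finset.sum_le_sum fun w _ ↦ ?_
  have h := normAtPlace_add_le w (u - x) x
  rw [sub_add_cancel] at h
  set A := normAtPlace w u
  set B := normAtPlace w (u - x)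
  set C := normAtPlace w x
  have hA : 0 ≤ A := normAtPlace_nonneg w u
  have hB : 0 ≤ B := normAtPlace_nonneg w _
  have hC : 0 ≤ C := normAtPlace_nonneg w x
  have h1 : (1 - η) * A ^ 2 ≤ B ^ 2 + C ^ 2 / η := by
    have h2 : C ^ 2 / η = C ^ 2 / η ∧ C ^ 2 = η * (C ^ 2 / η) := ⟨rfl, by field_simp⟩
    have h3 : A - C ≤ B := by linarith
    rcases le_total A C with hAC | hAC
    · have : A ^ 2 ≤ C ^ 2 := by gcongr
      rcases le_total η 1 with h1 | h1
      · have : C ^ 2 ≤ C ^ 2 / η := by rw [le_div_iff₀ hη]; nlinarith [sq_nonneg C]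
        nlinarith [sq_nonneg A, sq_nonneg B]
      · have : 0 ≤ C ^ 2 / η := by positivity
        nlinarith [sq_nonneg A, sq_nonneg B]
    · have h4 : (A - C) ^ 2 ≤ B ^ 2 := by gcongr
      have h5 : 0 ≤ (η * A - C) ^ 2 / η := by positivity
      have h6 : (η * A - C) ^ 2 / η = η * A ^ 2 - 2 * A * C + C ^ 2 / η := by
        field_simp
        ring
      nlinarith [sq_nonneg C]
  calc (1 - η) * (a w * A ^ 2) = a w * ((1 - η) * A ^ 2) := by ring
    _ ≤ a w * (B ^ 2 + C ^ 2 / η) := mul_le_mul_of_nonneg_left h1 (ha w)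
    _ = _ := by ring

theorem gaussVol_pos {a : InfinitePlace L → ℝ} (ha : ∀ w, 0 < a w) : 0 < gaussVol a :=
  Finset.prod_pos fun w _ ↦ Real.rpow_pos_of_pos (div_pos Real.pi_pos (ha w)) _

theorem gaussVol_const_mul {c : ℝ} (hc : 0 < c) {a : InfinitePlace L → ℝ} (ha : ∀ w, 0 < a w) :
    gaussVol (fun w ↦ c * a w) = c ^ (-(Module.finrank ℚ L : ℝ) / 2) * gaussVol a := by
  have h : ∏ w : InfinitePlace L, c ^ (-((w.mult : ℝ) / 2)) =
      c ^ (-(Module.finrank ℚ L : ℝ) / 2) := by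
    rw [← Real.rpow_sum_of_pos hc, Finset.sum_neg_distrib, ← Finset.sum_div, ← Nat.cast_sum,
      sum_mult_eq, neg_div]
  rw [gaussVol, gaussVol, ← h, ← Finset.prod_mul_distrib]
  refine Finset.prod_congr rfl fun w _ ↦ ?_
  rw [Real.rpow_neg hc.le, ← Real.inv_rpow hc.le, ← Real.mul_rpow (by positivity)
    (div_pos Real.pi_pos (ha w)).le]
  congr 1
  have := ha w
  field_simp

theorem lintegral_exp_neg_prod {ι κ : Type*} [Fintype ι] [Fintype κ] {a : ι → ℝ} {b : κ → ℝ}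
    (ha : ∀ i, 0 < a i) (hb : ∀ i, 0 < b i) :
    ∫⁻ x : (ι → ℝ) × (κ → ℂ), ENNReal.ofReal ((∏ i, Real.exp (-a i * x.1 i ^ 2)) *
        ∏ i, Real.exp (-b i * ‖x.2 i‖ ^ 2)) =
      ENNReal.ofReal ((∏ i, √(Real.pi / a i)) * ∏ i, Real.pi / b i) := by
  have hc (b : ℝ) (hb : 0 < b) : ∫ z : ℂ, Real.exp (-b * ‖z‖ ^ 2) = Real.pi / b := by
    rw [GaussianFourier.integral_rexp_neg_mul_sq_norm hb]
    simp
  have hic (b : ℝ) (hb : 0 < b) : Integrable fun z : ℂ ↦ Real.exp (-b * ‖z‖ ^ 2) := by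
    by_contra h
    have := hc b hb
    rw [integral_undef h] at this
    exact (div_pos Real.pi_pos hb).ne this
  have hi1 : Integrable fun x : ι → ℝ ↦ ∏ i, Real.exp (-a i * x i ^ 2) :=
    Integrable.fintype_prod fun i ↦ integrable_exp_neg_mul_sq (ha i)
  have hi2 : Integrable fun x : κ → ℂ ↦ ∏ i, Real.exp (-b i * ‖x i‖ ^ 2) :=
    Integrable.fintype_prod fun i ↦ hic _ (hb i)
  rw [Measure.volume_eq_prod, ← ofReal_integral_eq_lintegral_ofReal (hi1.mul_prod hi2)
      (ae_of_all _ fun x ↦ by positivity),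
    integral_prod_mul (fun x : ι → ℝ ↦ ∏ i, Real.exp (-a i * x i ^ 2))
      (fun x : κ → ℂ ↦ ∏ i, Real.exp (-b i * ‖x i‖ ^ 2)),
    integral_fintype_prod_volume_eq_prod (fun i (x : ℝ) ↦ Real.exp (-a i * x ^ 2)),
    integral_fintype_prod_volume_eq_prod (fun i (x : ℂ) ↦ Real.exp (-b i * ‖x‖ ^ 2))]
  simp_rw [integral_gaussian, hc _ (hb _)]

open scoped Classical in
theorem lintegral_expNeg_placeForm {a : InfinitePlace L → ℝ} (ha : ∀ w, 0 < a w) :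
    ∫⁻ x, expNeg (placeForm a x) = ENNReal.ofReal (gaussVol a) := by
  have hsplit (x : mixedSpace L) : expNeg (placeForm a x) = ENNReal.ofReal
      ((∏ w : {w : InfinitePlace L // w.IsReal}, Real.exp (-a w.1 * x.1 w ^ 2)) *
        ∏ w : {w : InfinitePlace L // w.IsComplex}, Real.exp (-a w.1 * ‖x.2 w‖ ^ 2)) := by
    rw [expNeg, placeForm, ← Finset.sum_neg_distrib, Real.exp_sum, prod_eq_prod_mul_prod]
    congr 2
    · refine Finset.prod_congr rfl fun w _ ↦ ?_
      rw [normAtPlace_apply_of_isReal w.2, Real.norm_eq_abs, sq_abs, neg_mul]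
    · refine Finset.prod_congr rfl fun w _ ↦ ?_
      rw [normAtPlace_apply_of_isComplex w.2, neg_mul]
  rw [lintegral_congr hsplit]
  have key := lintegral_exp_neg_prod (ι := {w : InfinitePlace L // w.IsReal})
    (κ := {w : InfinitePlace L // w.IsComplex}) (a := fun w ↦ a w.1) (b := fun w ↦ a w.1)
    (fun w ↦ ha w.1) (fun w ↦ ha w.1)
  rw [key]
  rw [gaussVol, prod_eq_prod_mul_prod]
  congr 2
  · refine Finset.prod_congr rfl fun w _ ↦ ?_
    rw [mult_isReal, Real.sqrt_eq_rpow]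
    norm_num
  · refine Finset.prod_congr rfl fun w _ ↦ ?_
    rw [mult_isComplex]
    norm_num

/-- The covolume of an ideal in the mixed space. -/
noncomputable def idealCovol (J : (Ideal (𝓞 L))⁰) : ℝ :=
  (Ideal.absNorm (J : Ideal (𝓞 L)) : ℝ) * 2⁻¹ ^ nrComplexPlaces L * √|(discr L : ℝ)|

theorem idealCovol_pos (J : (Ideal (𝓞 L))⁰) : 0 < idealCovol J := by
  have h1 : 0 < Ideal.absNorm (J : Ideal (𝓞 L)) := Ideal.absNorm_pos_of_nonZeroDivisors J
  have h2 : (0 : ℝ) < |(discr L : ℝ)| := by exact_mod_cast abs_pos.mpr (discr_ne_zero L)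
  have h3 : 0 < √|(discr L : ℝ)| := Real.sqrt_pos.mpr h2
  unfold idealCovol
  positivity

variable (a : InfinitePlace L → ℝ)

/-- The theta series of an ideal with respect to the quadratic form with coefficients `a`. -/
noncomputable def idealTheta (J : Ideal (𝓞 L)) (a : InfinitePlace L → ℝ) : ℝ≥0∞ :=
  ∑' x : J, expNeg (∑ w, a w * (w ((x : 𝓞 L) : L)) ^ 2)

theorem tsum_idealLattice (J : (Ideal (𝓞 L))⁰) (a : InfinitePlace L → ℝ) :
    ∑' v : idealLattice L (FractionalIdeal.mk0 L J), expNeg (placeForm a v) =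
      idealTheta (J : Ideal (𝓞 L)) a := by
  let e : ↥(J : Ideal (𝓞 L)) → idealLattice L (FractionalIdeal.mk0 L J) := fun x ↦
    ⟨mixedEmbedding L ((x : 𝓞 L) : L), (mem_idealLattice L _).mpr
      ⟨_, by simp, rfl⟩⟩
  have he : Function.Bijective e := by
    constructor
    · intro x y h
      have := (mixedEmbedding L).injective (congrArg Subtype.val h)
      exact Subtype.ext (RingOfIntegers.ext this)
    · rintro ⟨v, hv⟩
      obtain ⟨y, hy, rfl⟩ := (mem_idealLattice L _).mp hv
      obtain ⟨z, hz, rfl⟩ : ∃ z ∈ (J : Ideal (𝓞 L)), algebraMap (𝓞 L) L z = y := by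
        simpa using hy
      exact ⟨⟨z, hz⟩, rfl⟩
  rw [← (Equiv.ofBijective e he).tsum_eq, idealTheta]
  refine tsum_congr fun x ↦ ?_
  simp [e, placeForm, normAtPlace_apply]

open scoped Classical in
theorem volume_fundamentalDomain_idealLattice (J : (Ideal (𝓞 L))⁰) :
    volume (ZSpan.fundamentalDomain (E := mixedSpace L)
      (fractionalIdealLatticeBasis L (FractionalIdeal.mk0 L J))) =
      ENNReal.ofReal (idealCovol J) := by
  have h := mixedEmbedding.covolume_idealLattice L (FractionalIdeal.mk0 L J)
  rw [ZLattice.covolume_eq_measure_fundamentalDomain _ _ (fundamentalDomain_idealLattice L _),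
    measureReal_def] at h
  rw [idealCovol, ← ENNReal.ofReal_toReal (a := volume _), h]
  · simp [FractionalIdeal.coe_mk0, FractionalIdeal.coeIdeal_absNorm]
  · exact (ZSpan.fundamentalDomain_isBounded _).measure_lt_top.ne

instance (I : (FractionalIdeal (𝓞 L)⁰ L)ˣ) :
    MeasurableConstVAdd (idealLattice L I) (mixedSpace L) :=
  ⟨fun v ↦ measurable_const_add (v : mixedSpace L)⟩

open scoped Classical in
instance (I : (FractionalIdeal (𝓞 L)⁰ L)ˣ) :
    VAddInvariantMeasure (idealLattice L I) (mixedSpace L) volume :=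
  inferInstanceAs (VAddInvariantMeasure (idealLattice L I).toAddSubgroup (mixedSpace L) volume)

open scoped Classical in
theorem gaussVol_le_idealTheta (J : (Ideal (𝓞 L))⁰) {a : InfinitePlace L → ℝ}
    (ha : ∀ w, 0 < a w) :
    ENNReal.ofReal (gaussVol a / idealCovol J) ≤ idealTheta (J : Ideal (𝓞 L)) a := by
  have hG := gaussVol_pos ha
  have hV := idealCovol_pos J
  have h := sq_lintegral_le_tsum_lattice
    (fundamentalDomain_idealLattice L (FractionalIdeal.mk0 L J))
    (continuous_placeForm a).measurable (placeForm_parallelogram a)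
  simp_rw [placeForm_smul, ← placeForm_const_mul] at h
  rw [tsum_idealLattice, volume_fundamentalDomain_idealLattice,
    lintegral_expNeg_placeForm fun w ↦ mul_pos two_pos (ha w),
    lintegral_expNeg_placeForm fun w ↦ mul_pos (by norm_num) (ha w),
    gaussVol_const_mul two_pos ha, gaussVol_const_mul (by norm_num) ha] at h
  have h2 : ((2 : ℝ) ^ 2) ^ (-(Module.finrank ℚ L : ℝ) / 2) =
      (2 ^ (-(Module.finrank ℚ L : ℝ) / 2)) ^ 2 := by
    rw [← Real.rpow_natCast, ← Real.rpow_mul zero_le_two, ← Real.rpow_natCast,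
      ← Real.rpow_mul zero_le_two, mul_comm]
  have hc : 0 < (2 : ℝ) ^ (-(Module.finrank ℚ L : ℝ) / 2) := by positivity
  rw [h2] at h
  set c := (2 : ℝ) ^ (-(Module.finrank ℚ L : ℝ) / 2)
  by_cases htop : idealTheta (J : Ideal (𝓞 L)) a = ∞
  · simp [htop]
  rw [ENNReal.ofReal_le_iff_le_toReal htop, div_le_iff₀ hV]
  lift idealTheta (J : Ideal (𝓞 L)) a to NNReal using htop with T hT
  rw [← ENNReal.ofReal_coe_nnreal (p := T), ← ENNReal.ofReal_pow (by positivity),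
    ← ENNReal.ofReal_mul (by positivity), ← ENNReal.ofReal_mul (by positivity),
    ENNReal.ofReal_le_ofReal_iff (by positivity)] at h
  rw [ENNReal.coe_toReal]
  have h3 : 0 < c ^ 2 * gaussVol a := by positivity
  nlinarith

theorem exp_mul_rpow_le {B d t : ℝ} (hB : 0 ≤ B) (hd : 0 ≤ d) (ht : 0 ≤ t) (ht2 : t ≤ 1 / 2) :
    Real.exp (B * t) * (1 - t) ^ (-d / 2) ≤ 1 + (B + d) * Real.exp (B + d) * t := by
  have h0 : 0 < 1 - t := by linarith
  have h1 : (1 - t)⁻¹ ≤ Real.exp (2 * t) := by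
    refine le_trans ?_ (Real.add_one_le_exp _)
    rw [inv_le_iff_one_le_mul₀ h0]
    nlinarith
  have h2 : (1 - t) ^ (-d / 2) ≤ Real.exp (d * t) := by
    rw [neg_div, Real.rpow_neg h0.le, ← Real.inv_rpow h0.le]
    calc (1 - t)⁻¹ ^ (d / 2) ≤ Real.exp (2 * t) ^ (d / 2) := by gcongr
      _ = Real.exp (d * t) := by rw [← Real.exp_mul]; congr 1; ring
  calc Real.exp (B * t) * (1 - t) ^ (-d / 2) ≤ Real.exp (B * t) * Real.exp (d * t) := by gcongr
    _ = Real.exp ((B + d) * t) := by rw [← Real.exp_add]; congr 1; ring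
    _ ≤ 1 + (B + d) * t * Real.exp ((B + d) * t) := by
      have := Real.add_one_le_exp (-((B + d) * t))
      have h3 : Real.exp (-((B + d) * t)) * Real.exp ((B + d) * t) = 1 := by
        rw [← Real.exp_add]; simp
      nlinarith [Real.exp_pos ((B + d) * t)]
    _ ≤ 1 + (B + d) * t * Real.exp (B + d) := by
      gcongr
      nlinarith
    _ = _ := by ring

open scoped Classical in
theorem exists_idealTheta_le (J : (Ideal (𝓞 L))⁰) {M : ℝ} (hM : 0 ≤ M) :
    ∃ C : ℝ, 0 ≤ C ∧ ∀ t : ℝ, 0 < t → t ≤ 1 / 2 → ∀ a : InfinitePlace L → ℝ, (∀ w, 0 < a w) →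
      (∀ w, a w ≤ M * t ^ 2) →
      idealTheta (J : Ideal (𝓞 L)) a ≤
        ENNReal.ofReal ((1 + C * t) * (gaussVol a / idealCovol J)) := by
  obtain ⟨R, hR⟩ := (ZSpan.fundamentalDomain_isBounded (E := mixedSpace L)
    (fractionalIdealLatticeBasis L (FractionalIdeal.mk0 L J))).exists_norm_le
  set N : ℝ := Nat.cast (Fintype.card (InfinitePlace L))
  set B := N * (M * R ^ 2)
  set d : ℝ := Nat.cast (Module.finrank ℚ L)
  have hd : 0 ≤ d := by positivity
  have hB : 0 ≤ B := by positivity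
  refine ⟨(B + d) * Real.exp (B + d), by positivity, fun t ht ht2 a ha haM ↦ ?_⟩
  have hG := gaussVol_pos ha
  have hV := idealCovol_pos J
  have h1t : 0 < 1 - t := by linarith
  have hbound (x : mixedSpace L) (hx : ‖x‖ ≤ R) : placeForm a x / t ≤ B * t := by
    rw [div_le_iff₀ ht]
    calc placeForm a x ≤ ∑ _w : InfinitePlace L, M * t ^ 2 * R ^ 2 := by
          refine Finset.sum_le_sum fun w _ ↦ ?_
          have h1 : normAtPlace w x ≤ R := by
            refine le_trans ?_ hx
            rw [norm_eq_sup'_normAtPlace]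
            exact Finset.le_sup' (fun w ↦ normAtPlace w x) (Finset.mem_univ w)
          have h0 := normAtPlace_nonneg w x
          have := haM w
          have := ha w
          gcongr
      _ = B * t * t := by
          rw [Finset.sum_const, Finset.card_univ, nsmul_eq_mul]
          ring
  have h := tsum_lattice_le (fundamentalDomain_idealLattice L (FractionalIdeal.mk0 L J))
    (continuous_placeForm a).measurable (B := B * t) (η := t) fun u x hx ↦
      (placeForm_sub_le (fun w ↦ (ha w).le) ht u x).trans (by gcongr; exact hbound x (hR x hx))
  simp_rw [← placeForm_const_mul] at h
  rw [tsum_idealLattice, volume_fundamentalDomain_idealLattice,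
    lintegral_expNeg_placeForm fun w ↦ mul_pos h1t (ha w),
    gaussVol_const_mul h1t ha, expNeg, neg_neg, ← ENNReal.ofReal_mul (by positivity)] at h
  rw [← ENNReal.mul_le_mul_iff_right (a := ENNReal.ofReal (idealCovol J)) (by simpa using hV)
    ENNReal.ofReal_ne_top, ← ENNReal.ofReal_mul hV.le]
  refine h.trans (ENNReal.ofReal_le_ofReal ?_)
  calc Real.exp (B * t) * ((1 - t) ^ (-d / 2) * gaussVol a)
      = Real.exp (B * t) * (1 - t) ^ (-d / 2) * gaussVol a := by ring
    _ ≤ (1 + (B + d) * Real.exp (B + d) * t) * gaussVol a := by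
      gcongr
      exact exp_mul_rpow_le hB hd ht.le ht2
    _ = _ := by field_simp

end Theta

section Unfolding

variable {L : Type*} [Field L] [NumberField L]

open NumberField.InfinitePlace NumberField.mixedEmbedding NumberField.Units
  NumberField.Units.dirichletUnitTheorem

open scoped Classical

/-- The point of `ℝ ^ {infinite places}` with coordinate sum `t` whose direction is given by `z`. -/
noncomputable def logVec (t : ℝ) (z : logSpace L) (w : InfinitePlace L) : ℝ :=
  (if h : w = w₀ then -∑ v, z v else z ⟨w, h⟩) + w.mult * (t / Module.finrank ℚ L)

theorem sum_logVec (t : ℝ) (z : logSpace L) : ∑ w, logVec t z w = t := by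
  have hd : (Module.finrank ℚ L : ℝ) ≠ 0 := by exact_mod_cast Module.finrank_pos.ne'
  simp only [logVec, Finset.sum_add_distrib]
  rw [← Finset.sum_mul, ← Nat.cast_sum, sum_mult_eq, mul_div_cancel₀ _ hd,
    Fintype.sum_eq_add_sum_subtype_ne _ w₀]
  have : ∑ v : {w : InfinitePlace L // w ≠ w₀}, (if h : v.1 = w₀ then -∑ v, z v else z ⟨v.1, h⟩) =
      ∑ v, z v := Finset.sum_congr rfl fun v _ ↦ by rw [dif_neg v.2]
  rw [this]
  simp

theorem logVec_add (s t : ℝ) (y z : logSpace L) (w : InfinitePlace L) :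
    logVec (s + t) (y + z) w = logVec s y w + logVec t z w := by
  simp only [logVec, Pi.add_apply, Finset.sum_add_distrib]
  split_ifs <;> ring

theorem continuous_logVec (t : ℝ) (w : InfinitePlace L) :
    Continuous fun z : logSpace L ↦ logVec t z w := by
  unfold logVec
  split_ifs <;> fun_prop

/-- The coefficients of the quadratic form attached to `logVec t z`. -/
noncomputable def logCoeff (t : ℝ) (z : logSpace L) (w : InfinitePlace L) : ℝ :=
  Real.exp (2 * logVec t z w / w.mult)

theorem continuous_logCoeff (t : ℝ) (w : InfinitePlace L) :
    Continuous fun z : logSpace L ↦ logCoeff t z w := by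
  unfold logCoeff
  have := continuous_logVec (L := L) t w
  fun_prop

theorem gaussVol_logCoeff (t : ℝ) (z : logSpace L) :
    gaussVol (logCoeff t z) = Real.pi ^ ((Module.finrank ℚ L : ℝ) / 2) * Real.exp (-t) := by
  have h (w : InfinitePlace L) : (Real.pi / logCoeff t z w) ^ ((w.mult : ℝ) / 2) =
      Real.pi ^ ((w.mult : ℝ) / 2) * Real.exp (-logVec t z w) := by
    have hm : (w.mult : ℝ) ≠ 0 := mult_coe_ne_zero
    rw [logCoeff, Real.div_rpow Real.pi_pos.le (Real.exp_pos _).le, ← Real.exp_mul, div_eq_mul_inv,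
      ← Real.exp_neg]
    congr 2
    field_simp
  simp_rw [gaussVol, h]
  rw [Finset.prod_mul_distrib, ← Real.exp_sum, Finset.sum_neg_distrib, sum_logVec,
    ← Real.rpow_sum_of_pos Real.pi_pos, ← Finset.sum_div, ← Nat.cast_sum, sum_mult_eq]

/-- The weight attached to `logVec t z`. -/
noncomputable def logWeight (t : ℝ) (z : logSpace L) : ℝ≥0∞ := expNeg (∑ w, logCoeff t z w)

variable (L) in
/-- The integral of `logWeight t` over the hyperplane of vectors with coordinate sum `t`. -/
noncomputable def planeWeight (t : ℝ) : ℝ≥0∞ := ∫⁻ z : logSpace L, logWeight t z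

variable (L) in
/-- The sum of `planeWeight` over all nonzero ideals. -/
noncomputable def idealSum (t : ℝ) : ℝ≥0∞ :=
  ∑' I : (Ideal (𝓞 L))⁰, planeWeight L (t + Real.log (Ideal.absNorm (I : Ideal (𝓞 L))))

/-- The logarithm of the norm of an algebraic integer. -/
noncomputable def logNorm (x : 𝓞 L) : ℝ := Real.log (Ideal.absNorm (Ideal.span {x}))

/-- The direction of an algebraic integer in the logarithmic space. -/
noncomputable def logDir (x : 𝓞 L) : logSpace L := fun w ↦
  w.1.mult * Real.log (w.1 (x : L)) - w.1.mult * (logNorm x / Module.finrank ℚ L)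

theorem sum_mult_log {x : 𝓞 L} (hx : x ≠ 0) :
    ∑ w : InfinitePlace L, w.mult * Real.log (w (x : L)) = logNorm x := by
  have hx' : (x : L) ≠ 0 := by simpa using hx
  have h : (Ideal.absNorm (Ideal.span {x}) : ℝ) = ∏ w : InfinitePlace L, w (x : L) ^ w.mult := by
    rw [prod_eq_abs_norm, Ideal.absNorm_span_singleton, ← Algebra.coe_norm_int]
    simp
  rw [logNorm, h, Real.log_prod fun w _ ↦ pow_ne_zero _ (by simpa using hx)]
  simp

theorem logVec_logNorm {x : 𝓞 L} (hx : x ≠ 0) (w : InfinitePlace L) :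
    logVec (logNorm x) (logDir x) w = w.mult * Real.log (w (x : L)) := by
  have hd : (Module.finrank ℚ L : ℝ) ≠ 0 := by exact_mod_cast Module.finrank_pos.ne'
  have key (v : InfinitePlace L) (hv : v ≠ w₀) :
      logVec (logNorm x) (logDir x) v = v.mult * Real.log (v (x : L)) := by
    rw [logVec, dif_neg hv, logDir]
    ring
  by_cases hw : w = w₀
  · subst hw
    have h1 := sum_logVec (logNorm x) (logDir x)
    have h2 := sum_mult_log hx
    rw [Fintype.sum_eq_add_sum_subtype_ne _ w₀] at h1 h2
    rw [Finset.sum_congr rfl fun (v : {w : InfinitePlace L // w ≠ w₀}) _ ↦ key v.1 v.2] at h1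
    exact add_right_cancel (h1.trans h2.symm)
  · exact key w hw

theorem expNeg_sum_logCoeff_mul {x : 𝓞 L} (hx : x ≠ 0) (t : ℝ) (z : logSpace L) :
    expNeg (∑ w, logCoeff t z w * (w (x : L)) ^ 2) =
      logWeight (t + logNorm x) (z + logDir x) := by
  rw [logWeight]
  congr 1
  refine Finset.sum_congr rfl fun w _ ↦ ?_
  have hw : 0 < w (x : L) := pos_iff.mpr (by simpa using hx)
  have hm : (w.mult : ℝ) ≠ 0 := mult_coe_ne_zero
  rw [logCoeff, logCoeff, logVec_add, logVec_logNorm hx]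
  have : 2 * (logVec t z w + w.mult * Real.log (w (x : L))) / w.mult =
      2 * logVec t z w / w.mult + 2 * Real.log (w (x : L)) := by field_simp
  rw [this, Real.exp_add, two_mul (Real.log _), Real.exp_add, Real.exp_log hw, sq]

theorem logNorm_unit_mul (u : (𝓞 L)ˣ) (x : 𝓞 L) : logNorm ((u : 𝓞 L) * x) = logNorm x := by
  rw [logNorm, logNorm, Ideal.span_singleton_mul_left_unit u.isUnit]

theorem logDir_unit_mul (u : (𝓞 L)ˣ) {x : 𝓞 L} (hx : x ≠ 0) :
    logDir ((u : 𝓞 L) * x) = logEmbedding L (Additive.ofMul u) + logDir x := by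
  ext w
  have h1 : w.1 (u : L) ≠ 0 := by simp
  have h2 : w.1 (x : L) ≠ 0 := by simpa using hx
  rw [Pi.add_apply, logEmbedding_component, logDir, logDir, logNorm_unit_mul,
    RingOfIntegers.coe_eq_algebraMap, map_mul, map_mul, Real.log_mul h1 h2]
  ring

theorem tsum_logEmbedding (g : logSpace L → ℝ≥0∞) :
    ∑' u : (𝓞 L)ˣ, g (logEmbedding L (Additive.ofMul u)) =
      torsionOrder L * ∑' v : unitLattice L, g v := by
  have hs (v : unitLattice L) : ∃ u : (𝓞 L)ˣ, logEmbedding L (Additive.ofMul u) = v := by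
    obtain ⟨u, -, hu⟩ := v.2
    exact ⟨u.toMul, hu⟩
  choose s hs using hs
  let e : torsion L × unitLattice L → (𝓞 L)ˣ := fun p ↦ p.1 * s p.2
  have hlog (p : torsion L × unitLattice L) : logEmbedding L (Additive.ofMul (e p)) = p.2 := by
    rw [← hs p.2, ofMul_mul, map_add, logEmbedding_eq_zero_iff.mpr p.1.2, zero_add]
  have he : Function.Bijective e := by
    constructor
    · intro p p' h
      have h2 : p.2 = p'.2 := Subtype.ext <| by rw [← hlog p, ← hlog p', h]
      have h1 : (p.1 : (𝓞 L)ˣ) * s p.2 = p'.1 * s p'.2 := h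
      rw [h2] at h1
      exact Prod.ext (Subtype.ext (mul_right_cancel h1)) h2
    · intro u
      let v : unitLattice L := ⟨logEmbedding L (Additive.ofMul u), ⟨Additive.ofMul u, trivial, rfl⟩⟩
      have : u * (s v)⁻¹ ∈ torsion L := by
        rw [← logEmbedding_eq_zero_iff, ofMul_mul, map_add, ofMul_inv, map_neg, hs v]
        exact add_neg_cancel _
      exact ⟨(⟨_, this⟩, v), by simp [e]⟩
  rw [← (Equiv.ofBijective e he).tsum_eq]
  simp only [Equiv.ofBijective_apply, hlog]
  rw [ENNReal.tsum_prod (f := fun _ (v : unitLattice L) ↦ g v)]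
  simp [torsionOrder, ENNReal.tsum_const, ENat.card_eq_coe_natCard]

variable (L) in
/-- A fundamental domain of the unit lattice. -/
noncomputable def unitDomain : Set (logSpace L) :=
  ZSpan.fundamentalDomain ((basisUnitLattice L).ofZLatticeBasis ℝ (unitLattice L))

theorem isAddFundamentalDomain_unitDomain :
    IsAddFundamentalDomain (unitLattice L) (unitDomain L) :=
  ZLattice.isAddFundamentalDomain _ _

theorem volume_unitDomain : volume (unitDomain L) = ENNReal.ofReal (regulator L) := by
  rw [regulator, ZLattice.covolume_eq_measure_fundamentalDomain _ _
    isAddFundamentalDomain_unitDomain, measureReal_def, ENNReal.ofReal_toReal]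
  exact (ZSpan.fundamentalDomain_isBounded _).measure_lt_top.ne

instance : MeasurableConstVAdd (unitLattice L) (logSpace L) :=
  ⟨fun v ↦ measurable_const_add (v : logSpace L)⟩

instance : VAddInvariantMeasure (unitLattice L) (logSpace L) volume :=
  inferInstanceAs (VAddInvariantMeasure (unitLattice L).toAddSubgroup (logSpace L) volume)

theorem tsum_units_lintegral {x : 𝓞 L} (hx : x ≠ 0) (t : ℝ) :
    ∑' u : (𝓞 L)ˣ, ∫⁻ z in unitDomain L,
        logWeight (t + logNorm ((u : 𝓞 L) * x)) (z + logDir ((u : 𝓞 L) * x)) =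
      torsionOrder L * planeWeight L (t + logNorm x) := by
  simp_rw [logNorm_unit_mul, logDir_unit_mul _ hx]
  rw [tsum_logEmbedding fun v ↦
    ∫⁻ z in unitDomain L, logWeight (t + logNorm x) (z + (v + logDir x)),
    planeWeight, ← lintegral_add_right_eq_self _ (logDir x),
    isAddFundamentalDomain_unitDomain.lintegral_eq_tsum'']
  congr 1
  refine tsum_congr fun v ↦ lintegral_congr fun z ↦ ?_
  rw [Submodule.vadd_def, vadd_eq_add, add_left_comm, add_assoc]

theorem tsum_ne_zero_eq_tsum_ideals (J : (Ideal (𝓞 L))⁰) (f : 𝓞 L → ℝ≥0∞) :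
    ∃ g : {I : (Ideal (𝓞 L))⁰ // ClassGroup.mk0 I * ClassGroup.mk0 J = 1} → 𝓞 L,
      (∀ I, g I ≠ 0) ∧ (∀ I, Ideal.span {g I} = I.1 * J) ∧
      ∑' x : (J : Ideal (𝓞 L)), f x = f 0 + ∑' I, ∑' u : (𝓞 L)ˣ, f (u * g I) := by
  have hg (I : {I : (Ideal (𝓞 L))⁰ // ClassGroup.mk0 I * ClassGroup.mk0 J = 1}) :
      ∃ g : 𝓞 L, Ideal.span {g} = I.1 * J := by
    have h := I.2
    rw [← map_mul, ClassGroup.mk0_eq_one_iff] at h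
    obtain ⟨g, hg⟩ := h.principal
    exact ⟨g, hg.symm⟩
  choose g hg using hg
  have hg0 (I) : g I ≠ 0 := by
    intro h
    have h1 := hg I
    rw [h, Ideal.span_singleton_eq_bot.mpr rfl, eq_comm] at h1
    exact nonZeroDivisors.coe_ne_zero (I.1 * J) h1
  refine ⟨g, hg0, hg, ?_⟩
  have hmem (I) (u : (𝓞 L)ˣ) : (u : 𝓞 L) * g I ∈ (J : Ideal (𝓞 L)) := by
    have h : (J : Ideal (𝓞 L)) ∣ Ideal.span {g I} := ⟨_, (hg I).trans (mul_comm _ _)⟩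
    rw [Ideal.dvd_span_singleton] at h
    exact Ideal.mul_mem_left _ _ h
  let e : (_ : {I : (Ideal (𝓞 L))⁰ // ClassGroup.mk0 I * ClassGroup.mk0 J = 1}) × (𝓞 L)ˣ →
      ↥(({0} : Set (J : Ideal (𝓞 L)))ᶜ) := fun p ↦
    ⟨⟨p.2 * g p.1, hmem _ _⟩, by simp [Subtype.ext_iff, hg0]⟩
  have he : Function.Bijective e := by
    constructor
    · rintro ⟨I, u⟩ ⟨I', u'⟩ h
      have h1 : (u : 𝓞 L) * g I = u' * g I' := congrArg (fun x ↦ (x.1 : 𝓞 L)) h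
      have h2 : Ideal.span {g I} = Ideal.span {g I'} := by
        rw [← Ideal.span_singleton_mul_left_unit u.isUnit, h1,
          Ideal.span_singleton_mul_left_unit u'.isUnit]
      rw [hg, hg] at h2
      have h3 : I = I' := Subtype.ext <| Subtype.ext <|
        mul_right_cancel₀ (nonZeroDivisors.coe_ne_zero J) h2
      subst h3
      rw [Units.ext (mul_right_cancel₀ (hg0 I) h1)]
    · rintro ⟨⟨x, hx⟩, hx0⟩
      have hx0' : x ≠ 0 := by simpa [Subtype.ext_iff] using hx0
      obtain ⟨I, hI⟩ := Ideal.dvd_iff_le.mpr ((Ideal.span_singleton_le_iff_mem _).mpr hx)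
      have hI0 : I ≠ 0 := by
        rintro rfl
        rw [mul_zero] at hI
        exact hx0' (Ideal.span_singleton_eq_bot.mp hI)
      let I₁ : (Ideal (𝓞 L))⁰ := ⟨I, mem_nonZeroDivisors_of_ne_zero hI0⟩
      have hI₁ : ClassGroup.mk0 I₁ * ClassGroup.mk0 J = 1 := by
        rw [← map_mul, ClassGroup.mk0_eq_one_iff]
        exact ⟨⟨x, by rw [Submonoid.coe_mul, mul_comm]; exact hI.symm⟩⟩
      have h1 : Ideal.span {g ⟨I₁, hI₁⟩} = Ideal.span {x} := by rw [hg, hI, mul_comm]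
      obtain ⟨u, hu⟩ := Ideal.span_singleton_eq_span_singleton.mp h1
      exact ⟨⟨⟨I₁, hI₁⟩, u⟩, Subtype.ext <| Subtype.ext <| (mul_comm _ _).trans hu⟩
  rw [← ENNReal.summable.tsum_add_tsum_compl (s := {(0 : (J : Ideal (𝓞 L)))}) ENNReal.summable,
    tsum_singleton (0 : (J : Ideal (𝓞 L))) fun x ↦ f (x : 𝓞 L),
    ← (Equiv.ofBijective e he).tsum_eq, ENNReal.tsum_sigma']
  rfl

theorem lintegral_idealTheta (J : (Ideal (𝓞 L))⁰) (t : ℝ) :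
    ∫⁻ z in unitDomain L, idealTheta (J : Ideal (𝓞 L)) (logCoeff t z) =
      ENNReal.ofReal (regulator L) + torsionOrder L *
        ∑' I : {I : (Ideal (𝓞 L))⁰ // ClassGroup.mk0 I * ClassGroup.mk0 J = 1},
          planeWeight L (t + Real.log (Ideal.absNorm (J : Ideal (𝓞 L))) +
            Real.log (Ideal.absNorm (I : Ideal (𝓞 L)))) := by
  unfold idealTheta
  have : Countable (𝓞 L) := Finsupp.Countable.of_moduleFinite (R := ℤ)
  rw [lintegral_tsum fun x ↦ ?_]
  swap
  · refine (measurable_expNeg.comp (Continuous.measurable ?_)).aemeasurable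
    exact continuous_finsetSum _ fun w _ ↦ (continuous_logCoeff t w).mul_const _
  obtain ⟨g, hg0, hg, h⟩ := tsum_ne_zero_eq_tsum_ideals J fun x ↦
    ∫⁻ z in unitDomain L, expNeg (∑ w, logCoeff t z w * (w (x : L)) ^ 2)
  rw [h, ← ENNReal.tsum_mul_left]
  congr 1
  · simp [expNeg, volume_unitDomain]
  refine tsum_congr fun I ↦ ?_
  have h0 (u : (𝓞 L)ˣ) : (u : 𝓞 L) * g I ≠ 0 := mul_ne_zero u.ne_zero (hg0 I)
  simp_rw [expNeg_sum_logCoeff_mul (h0 _)]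
  rw [tsum_units_lintegral (hg0 I), logNorm, hg I, map_mul, Nat.cast_mul, Real.log_mul, add_assoc,
    add_comm (Real.log _)]
  · simpa using Ideal.absNorm_ne_zero_of_nonZeroDivisors I.1
  · simpa using Ideal.absNorm_ne_zero_of_nonZeroDivisors J

end Unfolding

section ClassSum

variable {L : Type*} [Field L] [NumberField L]

open NumberField.InfinitePlace NumberField.mixedEmbedding NumberField.Units
  NumberField.Units.dirichletUnitTheorem

open scoped Classical

theorem exists_sum_lintegral_idealTheta : ∃ J : ClassGroup (𝓞 L) → (Ideal (𝓞 L))⁰, ∀ t : ℝ,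
    ∑ c, ∫⁻ z in unitDomain L, idealTheta (J c : Ideal (𝓞 L))
      (logCoeff (t - Real.log (Ideal.absNorm (J c : Ideal (𝓞 L)))) z) =
      ENNReal.ofReal (classNumber L * regulator L) + torsionOrder L * idealSum L t := by
  choose J hJ using fun c : ClassGroup (𝓞 L) ↦ ClassGroup.mk0_surjective c⁻¹
  refine ⟨J, fun t ↦ ?_⟩
  simp_rw [lintegral_idealTheta, sub_add_cancel]
  rw [Finset.sum_add_distrib, ← Finset.mul_sum, Finset.sum_const, Finset.card_univ, nsmul_eq_mul,
    ENNReal.ofReal_mul (Nat.cast_nonneg _), ENNReal.ofReal_natCast, ← classNumber]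
  congr 2
  rw [idealSum, ← (Equiv.sigmaFiberEquiv (ClassGroup.mk0 (R := 𝓞 L))).tsum_eq,
    ENNReal.tsum_sigma', tsum_fintype]
  refine Finset.sum_congr rfl fun c _ ↦ ?_
  have h (I : (Ideal (𝓞 L))⁰) :
      ClassGroup.mk0 I * ClassGroup.mk0 (J c) = 1 ↔ ClassGroup.mk0 I = c := by
    rw [hJ, mul_inv_eq_one]
  exact (Equiv.subtypeEquivRight h).tsum_eq fun I : {I : (Ideal (𝓞 L))⁰ // ClassGroup.mk0 I = c} ↦
    planeWeight L (t + Real.log (Ideal.absNorm (I.1 : Ideal (𝓞 L))))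

variable (L) in
/-- The constant in the main term of the theta integrals. -/
noncomputable def thetaConst : ℝ :=
  Real.pi ^ ((Module.finrank ℚ L : ℝ) / 2) * 2 ^ nrComplexPlaces L / √|(discr L : ℝ)|

theorem thetaConst_pos : 0 < thetaConst L := by
  have : (0 : ℝ) < |(discr L : ℝ)| := abs_pos.mpr (by exact_mod_cast discr_ne_zero L)
  unfold thetaConst
  positivity

theorem logCoeff_pos (t : ℝ) (z : logSpace L) (w : InfinitePlace L) : 0 < logCoeff t z w :=
  Real.exp_pos _

theorem gaussVol_div_idealCovol (J : (Ideal (𝓞 L))⁰) (t : ℝ) (z : logSpace L) :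
    gaussVol (logCoeff (t - Real.log (Ideal.absNorm (J : Ideal (𝓞 L)))) z) /
      idealCovol J = thetaConst L * Real.exp (-t) := by
  have hJ : (0 : ℝ) < Ideal.absNorm (J : Ideal (𝓞 L)) := by
    have := Ideal.absNorm_ne_zero_of_nonZeroDivisors J
    positivity
  have : (0 : ℝ) < |(discr L : ℝ)| := abs_pos.mpr (by exact_mod_cast discr_ne_zero L)
  rw [gaussVol_logCoeff, neg_sub, sub_eq_add_neg, Real.exp_add, Real.exp_log hJ, idealCovol,
    thetaConst]
  field_simp
  rw [← mul_pow]
  norm_num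

theorem le_idealSum (t : ℝ) :
    ENNReal.ofReal (classNumber L * regulator L * (thetaConst L * Real.exp (-t))) ≤
      ENNReal.ofReal (classNumber L * regulator L) + torsionOrder L * idealSum L t := by
  obtain ⟨J, hJ⟩ := exists_sum_lintegral_idealTheta (L := L)
  have key (c : ClassGroup (𝓞 L)) :
      ENNReal.ofReal (regulator L * (thetaConst L * Real.exp (-t))) ≤
        ∫⁻ z in unitDomain L, idealTheta (J c : Ideal (𝓞 L))
          (logCoeff (t - Real.log (Ideal.absNorm (J c : Ideal (𝓞 L)))) z) := by
    rw [mul_comm, ENNReal.ofReal_mul (by have := thetaConst_pos (L := L); positivity),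
      ← volume_unitDomain, ← setLIntegral_const]
    refine lintegral_mono fun z ↦ ?_
    rw [← gaussVol_div_idealCovol (J c) t z]
    exact gaussVol_le_idealTheta (J c) (logCoeff_pos _ _)
  rw [← hJ, mul_assoc, ENNReal.ofReal_mul (Nat.cast_nonneg _), ENNReal.ofReal_natCast,
    ← nsmul_eq_mul, classNumber, ← Finset.card_univ]
  exact Finset.card_nsmul_le_sum _ _ _ fun c _ ↦ key c

theorem logCoeff_eq (t : ℝ) (z : logSpace L) (w : InfinitePlace L) :
    logCoeff t z w = logCoeff 0 z w * Real.exp (t / Module.finrank ℚ L) ^ 2 := by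
  have hm : (w.mult : ℝ) ≠ 0 := mult_coe_ne_zero
  rw [logCoeff, logCoeff, ← Real.exp_nat_mul, ← Real.exp_add]
  congr 1
  simp only [logVec]
  field_simp
  push_cast
  ring

theorem exists_logCoeff_le :
    ∃ M : ℝ, 0 ≤ M ∧ ∀ z ∈ unitDomain L, ∀ w, logCoeff 0 z w ≤ M := by
  have h (w : InfinitePlace L) : ∃ M, ∀ z ∈ unitDomain L, logCoeff 0 z w ≤ M := by
    obtain ⟨M, hM⟩ := (ZSpan.fundamentalDomain_isBounded
      ((basisUnitLattice L).ofZLatticeBasis ℝ (unitLattice L))).isCompact_closure.bddAbove_image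
      (continuous_logCoeff 0 w).continuousOn
    exact ⟨M, fun z hz ↦ hM ⟨z, subset_closure hz, rfl⟩⟩
  choose M hM using h
  have hM0 (w) : M w ≤ ∑ v, |M v| := (le_abs_self _).trans <|
    Finset.single_le_sum (f := fun v ↦ |M v|) (fun v _ ↦ abs_nonneg _) (Finset.mem_univ w)
  exact ⟨∑ v, |M v|, by positivity, fun z hz w ↦ (hM w z hz).trans (hM0 w)⟩

variable (L) in
theorem exists_idealSum_le : ∃ C : ℝ, 0 ≤ C ∧ ∀ t : ℝ,
    Real.exp (t / Module.finrank ℚ L) ≤ 1 / 2 →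
      ENNReal.ofReal (classNumber L * regulator L) + torsionOrder L * idealSum L t ≤
        ENNReal.ofReal (classNumber L * regulator L * (thetaConst L * Real.exp (-t)) *
          (1 + C * Real.exp (t / Module.finrank ℚ L))) := by
  obtain ⟨J, hJ⟩ := exists_sum_lintegral_idealTheta (L := L)
  obtain ⟨M, hM0, hM⟩ := exists_logCoeff_le (L := L)
  choose C hC0 hC using fun c : ClassGroup (𝓞 L) ↦ exists_idealTheta_le (J c) hM0
  have hCs (c) : C c ≤ ∑ c, C c :=
    Finset.single_le_sum (f := C) (fun c _ ↦ hC0 c) (Finset.mem_univ c)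
  have hCs0 : 0 ≤ ∑ c, C c := Finset.sum_nonneg fun c _ ↦ hC0 c
  refine ⟨∑ c, C c, hCs0, fun t ht ↦ ?_⟩
  have hP := thetaConst_pos (L := L)
  set τ := Real.exp (t / Module.finrank ℚ L) with hτ
  have hτ0 : 0 < τ := Real.exp_pos _
  have key (c : ClassGroup (𝓞 L)) :
      ∫⁻ z in unitDomain L, idealTheta (J c : Ideal (𝓞 L))
          (logCoeff (t - Real.log (Ideal.absNorm (J c : Ideal (𝓞 L)))) z) ≤
      ENNReal.ofReal (regulator L * ((thetaConst L * Real.exp (-t)) *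
        (1 + (∑ c, C c) * τ))) := by
    rw [mul_comm, ENNReal.ofReal_mul (by positivity), ← volume_unitDomain, ← setLIntegral_const]
    refine setLIntegral_mono measurable_const fun z hz ↦ ?_
    refine (hC c τ hτ0 ht _ (logCoeff_pos _ _) fun w ↦ ?_).trans ?_
    · rw [logCoeff_eq]
      refine mul_le_mul (hM z hz w) ?_ (by positivity) hM0
      have : 0 ≤ Real.log (Ideal.absNorm (J c : Ideal (𝓞 L))) := Real.log_natCast_nonneg _
      rw [hτ]
      gcongr
      linarith
    · rw [gaussVol_div_idealCovol, mul_comm]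
      refine ENNReal.ofReal_le_ofReal ?_
      gcongr
      exact hCs c
  rw [← hJ, mul_assoc, mul_assoc, ENNReal.ofReal_mul (Nat.cast_nonneg _), ENNReal.ofReal_natCast,
    ← nsmul_eq_mul, classNumber, ← Finset.card_univ]
  exact Finset.sum_le_card_nsmul _ _ _ fun c _ ↦ key c

end ClassSum

section Mellin

theorem integrable_exp_neg_exp {s : ℝ} (hs : 0 < s) :
    Integrable fun u : ℝ ↦ Real.exp (s * u - Real.exp u) := by
  have h := Real.GammaIntegral_convergent hs
  rw [← Real.range_exp, ← Set.image_univ, integrableOn_image_iff_integrableOn_abs_deriv_smul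
    MeasurableSet.univ (fun x _ ↦ (Real.hasDerivAt_exp x).hasDerivWithinAt)
    Real.exp_injective.injOn, integrableOn_univ] at h
  refine h.congr (ae_of_all _ fun u ↦ ?_)
  simp only [smul_eq_mul]
  rw [abs_of_pos (Real.exp_pos _), ← Real.exp_mul, ← Real.exp_add, ← Real.exp_add]
  ring_nf

theorem integral_exp_neg_exp {s : ℝ} (hs : 0 < s) :
    ∫ u : ℝ, Real.exp (s * u - Real.exp u) = Real.Gamma s := by
  rw [Real.Gamma_eq_integral hs, ← Real.range_exp, ← Set.image_univ,
    integral_image_eq_integral_abs_deriv_smul MeasurableSet.univ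
      (fun x _ ↦ (Real.hasDerivAt_exp x).hasDerivWithinAt) Real.exp_injective.injOn,
    setIntegral_univ]
  refine integral_congr_ae (ae_of_all _ fun u ↦ ?_)
  simp only [smul_eq_mul]
  rw [abs_of_pos (Real.exp_pos _), ← Real.exp_mul, ← Real.exp_add, ← Real.exp_add]
  ring_nf

/-- The weight `exp (-t)` twisted by the exponential with parameter `s`. -/
theorem expNeg_mul_ofReal_exp (a b : ℝ) :
    expNeg a * ENNReal.ofReal (Real.exp b) = ENNReal.ofReal (Real.exp (b - a)) := by
  rw [expNeg, ← ENNReal.ofReal_mul (Real.exp_nonneg _), ← Real.exp_add]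
  ring_nf

theorem lintegral_expNeg_exp_sub {s : ℝ} (hs : 0 < s) (c : ℝ) :
    ∫⁻ t : ℝ, expNeg (Real.exp (t - c)) * ENNReal.ofReal (Real.exp (s * t)) =
      ENNReal.ofReal (Real.exp (s * c)) * ENNReal.ofReal (Real.Gamma s) := by
  rw [← lintegral_add_right_eq_self _ c]
  have h (t : ℝ) : expNeg (Real.exp (t + c - c)) * ENNReal.ofReal (Real.exp (s * (t + c))) =
      ENNReal.ofReal (Real.exp (s * c)) * ENNReal.ofReal (Real.exp (s * t - Real.exp t)) := by
    rw [expNeg_mul_ofReal_exp, ← ENNReal.ofReal_mul (Real.exp_nonneg _), ← Real.exp_add]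
    ring_nf
  simp_rw [h]
  rw [lintegral_const_mul _ (by fun_prop), ← integral_exp_neg_exp hs,
    ofReal_integral_eq_lintegral_ofReal (integrable_exp_neg_exp hs)
      (ae_of_all _ fun _ ↦ Real.exp_nonneg _)]

/-- The integral of `exp (-∑ exp u)` over the hyperplane of vectors with coordinate sum `t`,
parametrised by all coordinates but one. -/
noncomputable def simplexWeight (ι : Type*) [Fintype ι] (t : ℝ) : ℝ≥0∞ :=
  ∫⁻ y : ι → ℝ, expNeg (Real.exp (t - ∑ i, y i) + ∑ i, Real.exp (y i))

variable {ι κ : Type*} [Fintype ι] [Fintype κ]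

theorem measurable_simplexWeight : Measurable (simplexWeight ι) := by
  have h : Measurable fun p : ℝ × (ι → ℝ) ↦
      expNeg (Real.exp (p.1 - ∑ i, p.2 i) + ∑ i, Real.exp (p.2 i)) :=
    measurable_expNeg.comp (by fun_prop)
  exact h.lintegral_prod_right'

theorem simplexWeight_congr (e : ι ≃ κ) : simplexWeight ι = simplexWeight κ := by
  ext t
  rw [simplexWeight, simplexWeight,
    ← (volume_measurePreserving_piCongrLeft (fun _ ↦ ℝ) e).lintegral_comp_emb
      (MeasurableEquiv.measurableEmbedding _)]
  refine lintegral_congr fun y ↦ ?_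
  have h (f : ℝ → ℝ) :
      ∑ j, f (MeasurableEquiv.piCongrLeft (fun _ ↦ ℝ) e y j) = ∑ i, f (y i) := by
    rw [← e.sum_comp]
    exact Finset.sum_congr rfl fun i _ ↦ by rw [MeasurableEquiv.piCongrLeft_apply_apply]
  rw [h Real.exp, h fun x ↦ x]

theorem lintegral_simplexWeight {s : ℝ} (hs : 0 < s) :
    ∫⁻ t, simplexWeight ι t * ENNReal.ofReal (Real.exp (s * t)) =
      ENNReal.ofReal (Real.Gamma s ^ (Fintype.card ι + 1)) := by
  have hG := Real.Gamma_nonneg_of_nonneg hs.le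
  have hm : Measurable fun p : ℝ × (ι → ℝ) ↦
      expNeg (Real.exp (p.1 - ∑ i, p.2 i) + ∑ i, Real.exp (p.2 i)) :=
    measurable_expNeg.comp (by fun_prop)
  simp_rw [simplexWeight]
  have h1 (t : ℝ) : (∫⁻ y : ι → ℝ, expNeg (Real.exp (t - ∑ i, y i) + ∑ i, Real.exp (y i))) *
      ENNReal.ofReal (Real.exp (s * t)) =
      ∫⁻ y : ι → ℝ, expNeg (Real.exp (t - ∑ i, y i) + ∑ i, Real.exp (y i)) *
        ENNReal.ofReal (Real.exp (s * t)) :=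
    (lintegral_mul_const _ (hm.comp measurable_prodMk_left)).symm
  simp_rw [h1]
  rw [lintegral_lintegral_swap (hm.mul (by fun_prop)).aemeasurable]
  have h2 (y : ι → ℝ) : ∫⁻ t, expNeg (Real.exp (t - ∑ i, y i) + ∑ i, Real.exp (y i)) *
      ENNReal.ofReal (Real.exp (s * t)) = ENNReal.ofReal (Real.Gamma s) *
        ENNReal.ofReal (∏ i, Real.exp (s * y i - Real.exp (y i))) := by
    simp_rw [add_comm (Real.exp _) (∑ i, Real.exp (y i)), expNeg_add, mul_assoc]
    have hy : Measurable fun t : ℝ ↦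
        expNeg (Real.exp (t - ∑ i, y i)) * ENNReal.ofReal (Real.exp (s * t)) :=
      Measurable.mul (measurable_expNeg.comp (by fun_prop)) (by fun_prop)
    rw [lintegral_const_mul _ hy,
      lintegral_expNeg_exp_sub hs, ← mul_assoc, expNeg_mul_ofReal_exp, mul_comm, ← Real.exp_sum,
      Finset.sum_sub_distrib, Finset.mul_sum]
  simp_rw [h2]
  have hi : Integrable fun y : ι → ℝ ↦ ∏ i, Real.exp (s * y i - Real.exp (y i)) :=
    Integrable.fintype_prod fun _ ↦ integrable_exp_neg_exp hs
  rw [lintegral_const_mul _ (by fun_prop), ← ofReal_integral_eq_lintegral_ofReal hi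
    (ae_of_all _ fun y ↦ by positivity),
    integral_fintype_prod_volume_eq_prod (fun _ (u : ℝ) ↦ Real.exp (s * u - Real.exp u)),
    ← ENNReal.ofReal_mul hG]
  simp [integral_exp_neg_exp hs, pow_succ']

variable {L : Type*} [Field L] [NumberField L]

open NumberField.InfinitePlace NumberField.mixedEmbedding NumberField.Units
  NumberField.Units.dirichletUnitTheorem

open scoped Classical

theorem planeWeight_eq {m : ℕ} (hm : ∀ w : InfinitePlace L, w.mult = m) (t : ℝ) :
    planeWeight L t = ∫⁻ y : logSpace L,
      expNeg (Real.exp (2 / m * (t - ∑ v, y v)) + ∑ v, Real.exp (2 / m * y v)) := by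
  have hd : (Module.finrank ℚ L : ℝ) ≠ 0 := by exact_mod_cast Module.finrank_pos.ne'
  set c : logSpace L := fun _ ↦ m * (t / Module.finrank ℚ L) with hc
  rw [planeWeight, ← lintegral_add_right_eq_self
    (fun y : logSpace L ↦ expNeg (Real.exp (2 / m * (t - ∑ v, y v)) +
      ∑ v, Real.exp (2 / m * y v))) c]
  refine lintegral_congr fun z ↦ ?_
  have hv (v : {w : InfinitePlace L // w ≠ w₀}) : logVec t z v = (z + c) v := by
    rw [logVec, dif_neg v.2, hm, Pi.add_apply]
  have h0 : logVec t z w₀ = t - ∑ v, (z + c) v := by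
    have := sum_logVec t z
    rw [Fintype.sum_eq_add_sum_subtype_ne _ w₀] at this
    rw [Finset.sum_congr rfl fun (v : {w : InfinitePlace L // w ≠ w₀}) _ ↦ hv v] at this
    exact eq_sub_of_add_eq this
  rw [logWeight, Fintype.sum_eq_add_sum_subtype_ne _ w₀]
  simp_rw [logCoeff, hm, hv, h0]
  simp_rw [div_mul_eq_mul_div]

theorem planeWeight_of_isComplex (hL : ∀ w : InfinitePlace L, w.IsComplex) :
    planeWeight L = simplexWeight {w : InfinitePlace L // w ≠ w₀} := by
  ext t
  rw [planeWeight_eq (m := 2) fun w ↦ by simp [mult, (not_isReal_iff_isComplex).mpr (hL w)]]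
  simp [simplexWeight]

theorem planeWeight_of_isReal (hL : ∀ w : InfinitePlace L, w.IsReal) (t : ℝ) :
    simplexWeight {w : InfinitePlace L // w ≠ w₀} (2 * t) =
      2 ^ Units.rank L * planeWeight L t := by
  rw [planeWeight_eq (m := 1) fun w ↦ by simp [mult, hL w], simplexWeight]
  have h := Measure.map_addHaar_smul (volume : Measure (logSpace L)) (two_ne_zero (α := ℝ))
  have hv : (volume : Measure (logSpace L)) =
      (2 : ℝ≥0∞) ^ Units.rank L • Measure.map ((2 : ℝ) • ·) volume := by
    rw [h, Units.finrank_eq_rank, smul_smul, abs_of_pos (by positivity), ENNReal.ofReal_inv_of_pos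
      (by positivity), ENNReal.ofReal_pow zero_le_two, ENNReal.ofReal_ofNat,
      ENNReal.mul_inv_cancel (by simp) (by simp), one_smul]
  have hm : Measurable fun y : logSpace L ↦
      expNeg (Real.exp (2 * t - ∑ i, y i) + ∑ i, Real.exp (y i)) :=
    measurable_expNeg.comp (by fun_prop)
  conv_lhs => rw [hv]
  rw [lintegral_smul_measure, lintegral_map hm (by fun_prop)]
  simp [← Finset.mul_sum, mul_sub]

end Mellin

section Landau

open ProbabilityTheory

theorem lintegral_Iic_ofReal_exp {a : ℝ} (ha : 0 < a) (c : ℝ) :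
    ∫⁻ t in Set.Iic c, ENNReal.ofReal (Real.exp (a * t)) =
      ENNReal.ofReal (Real.exp (a * c) / a) := by
  rw [← integral_exp_mul_Iic ha, ofReal_integral_eq_lintegral_ofReal (integrableOn_exp_mul_Iic ha c)
    (ae_of_all _ fun _ ↦ Real.exp_nonneg _)]

theorem mgf_id_eq_toReal (ν : Measure ℝ) (s : ℝ) :
    mgf id ν s = (∫⁻ t, ENNReal.ofReal (Real.exp (s * t)) ∂ν).toReal :=
  integral_eq_lintegral_of_nonneg_ae (ae_of_all _ fun _ ↦ Real.exp_nonneg _)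
    (Measurable.aestronglyMeasurable (by fun_prop))

theorem mem_integrableExpSet_id_iff (ν : Measure ℝ) (s : ℝ) :
    s ∈ integrableExpSet id ν ↔ ∫⁻ t, ENNReal.ofReal (Real.exp (s * t)) ∂ν ≠ ∞ := by
  rw [integrableExpSet, Set.mem_ofPred_eq,
    ← lintegral_ofReal_ne_top_iff_integrable (Measurable.aestronglyMeasurable (by fun_prop))
      (ae_of_all _ fun _ ↦ Real.exp_nonneg _)]
  rfl

theorem isPreconnected_ball_diff_singleton (c : ℂ) (r : ℝ) :
    IsPreconnected (Metric.ball c r \ {c}) := by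
  rcases le_or_gt r 0 with hr | hr
  · simp [Metric.ball_eq_empty.mpr hr, isPreconnected_empty]
  have : Metric.ball c r \ {c} = (fun w ↦ c + Complex.exp w) '' {w | w.re < Real.log r} := by
    ext z
    simp only [Set.mem_sdiff, Metric.mem_ball, dist_eq_norm, Set.mem_singleton_iff, Set.mem_image,
      Set.mem_ofPred_eq]
    constructor
    · rintro ⟨h1, h2⟩
      have h3 : z - c ≠ 0 := sub_ne_zero.mpr h2
      refine ⟨Complex.log (z - c), ?_, by rw [Complex.exp_log h3]; ring⟩
      rw [Complex.log_re]
      exact Real.log_lt_log (norm_pos_iff.mpr h3) h1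
    · rintro ⟨w, hw, rfl⟩
      rw [add_sub_cancel_left, Complex.norm_exp]
      exact ⟨(Real.lt_log_iff_exp_lt hr).mp hw, by simp⟩
  rw [this]
  exact (convex_halfSpace_re_lt _).isPreconnected.image _ (by fun_prop)

/-- A function whose Taylor coefficients at `c` are those of the moment generating function of a
measure on the negative half-line is nonnegative to the left of `c`. -/
theorem nonneg_of_eventuallyEq_complexMGF {ν : Measure ℝ} (hν : ∀ᵐ t ∂ν, t ≤ 0) {H : ℂ → ℂ}
    {c x : ℝ} (hc : c ∈ interior (integrableExpSet id ν))
    (hH : DifferentiableOn ℂ H (Metric.ball (c : ℂ) c)) (hHc : H =ᶠ[𝓝 (c : ℂ)] complexMGF id ν)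
    (hx0 : 0 < x) (hxc : x ≤ c) : 0 ≤ H x := by
  have hx : (x : ℂ) ∈ Metric.ball (c : ℂ) c := by
    rw [Metric.mem_ball, Complex.dist_eq, ← Complex.ofReal_sub, Complex.norm_real, Real.norm_eq_abs,
      abs_lt]
    constructor <;> linarith
  refine (Complex.hasSum_taylorSeries_on_ball hH hx).nonneg fun n ↦ ?_
  rw [hHc.iteratedDeriv_eq, iteratedDeriv_complexMGF (by simpa using hc)]
  have h : ∫ t, (id t : ℂ) ^ n * Complex.exp (c * (id t : ℝ)) ∂ν =
      ((∫ t, t ^ n * Real.exp (c * t) ∂ν : ℝ) : ℂ) := by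
    rw [← integral_complex_ofReal]
    simp
  simp only [id] at h ⊢
  have h' : ((n.factorial : ℂ)⁻¹ • ((x : ℂ) - c) ^ n •
      ((∫ t, t ^ n * Real.exp (c * t) ∂ν : ℝ) : ℂ)) =
      (((n.factorial : ℝ)⁻¹ * ∫ t, (x - c) ^ n * (t ^ n * Real.exp (c * t)) ∂ν : ℝ) : ℂ) := by
    rw [integral_const_mul, smul_eq_mul, smul_eq_mul]
    push_cast
    rfl
  rw [h, h', Complex.zero_le_real]
  refine mul_nonneg (by positivity) (integral_nonneg_of_ae ?_)
  filter_upwards [hν] with t ht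
  rw [← mul_assoc, ← mul_pow]
  exact mul_nonneg (pow_nonneg (mul_nonneg_of_nonpos_of_nonpos (by linarith) ht) _)
    (Real.exp_nonneg _)

end Landau

section Landau

open ProbabilityTheory

theorem ofReal_exp_mul_exp (a b : ℝ) :
    ENNReal.ofReal (Real.exp a) * ENNReal.ofReal (Real.exp b) =
      ENNReal.ofReal (Real.exp (a + b)) := by
  rw [← ENNReal.ofReal_mul (Real.exp_nonneg _), Real.exp_add]

theorem mem_integrableExpSet_withDensity_Ioi {S : ℝ → ℝ≥0∞} (hS : Measurable S) {Λ : ℝ}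
    (h : ∀ s, 1 < s → ∫⁻ t, S t * ENNReal.ofReal (Real.exp (s * t)) ≠ ∞) (s : ℝ) :
    s ∈ integrableExpSet id ((volume.restrict (Set.Ioi Λ)).withDensity S) := by
  rw [mem_integrableExpSet_id_iff, lintegral_withDensity_eq_lintegral_mul _ hS (by fun_prop)]
  have hs : 1 < max s 2 := by simp
  refine ne_top_of_le_ne_top (b := (∫⁻ t, S t * ENNReal.ofReal (Real.exp (max s 2 * t))) *
    ENNReal.ofReal (Real.exp ((s - max s 2) * Λ))) (ENNReal.mul_ne_top (h _ hs) (by simp)) ?_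
  have hm : Measurable fun t ↦ S t * ENNReal.ofReal (Real.exp (max s 2 * t)) :=
    hS.mul (by fun_prop)
  rw [← lintegral_mul_const _ hm]
  refine (setLIntegral_mono (hm.mul_const _) fun t ht ↦ ?_).trans
    (setLIntegral_le_lintegral _ _)
  rw [mul_assoc, ofReal_exp_mul_exp, Pi.mul_apply]
  gcongr
  have : (s - max s 2) * t ≤ (s - max s 2) * Λ :=
    mul_le_mul_of_nonpos_left (le_of_lt ht) (by simp)
  linarith

theorem mem_integrableExpSet_withDensity_Iic {S T : ℝ → ℝ≥0∞}
    (hT : Measurable T) {Λ κ A T₀ δ : ℝ} (hTS : ∀ t, T t ≤ S t + ENNReal.ofReal κ)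
    (hTA : ∀ t ≤ T₀, T t ≤ ENNReal.ofReal (A * Real.exp ((δ - 1) * t)))
    (h : ∀ s, 1 < s → ∫⁻ t, S t * ENNReal.ofReal (Real.exp (s * t)) ≠ ∞) {s : ℝ}
    (hs : 1 - δ < s) :
    s ∈ integrableExpSet id ((volume.restrict (Set.Iic Λ)).withDensity T) := by
  rw [mem_integrableExpSet_id_iff, lintegral_withDensity_eq_lintegral_mul _ hT (by fun_prop)]
  have key (s : ℝ) (hs : 1 < s) :
      ∫⁻ t in Set.Iic Λ, T t * ENNReal.ofReal (Real.exp (s * t)) ≠ ∞ := by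
    refine ne_top_of_le_ne_top (b := (∫⁻ t, S t * ENNReal.ofReal (Real.exp (s * t))) +
      ENNReal.ofReal κ * ∫⁻ t in Set.Iic Λ, ENNReal.ofReal (Real.exp (s * t))) ?_ ?_
    · rw [lintegral_Iic_ofReal_exp (by linarith)]
      exact ENNReal.add_ne_top.mpr ⟨h s hs, ENNReal.mul_ne_top (by simp) (by simp)⟩
    · rw [← lintegral_const_mul _ (by fun_prop)]
      refine le_trans ?_ (add_le_add_left (setLIntegral_le_lintegral (Set.Iic Λ) _) _)
      rw [← lintegral_add_right _ (by fun_prop)]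
      refine lintegral_mono fun t ↦ ?_
      dsimp only
      rw [← add_mul]
      gcongr
      exact hTS t
  rcases lt_or_ge 1 s with hs1 | hs1
  · exact key s hs1
  refine ne_top_of_le_ne_top (b := (ENNReal.ofReal A *
    ∫⁻ t in Set.Iic Λ, ENNReal.ofReal (Real.exp ((δ - 1 + s) * t))) +
    (∫⁻ t in Set.Iic Λ, T t * ENNReal.ofReal (Real.exp (2 * t))) *
      ENNReal.ofReal (Real.exp ((s - 2) * T₀))) ?_ ?_
  · rw [lintegral_Iic_ofReal_exp (by linarith)]
    exact ENNReal.add_ne_top.mpr ⟨ENNReal.mul_ne_top (by simp) (by simp),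
      ENNReal.mul_ne_top (key 2 one_lt_two) (by simp)⟩
  have hm : Measurable fun t ↦ T t * ENNReal.ofReal (Real.exp (2 * t)) := hT.mul (by fun_prop)
  rw [← lintegral_const_mul _ (by fun_prop), ← lintegral_mul_const _ hm,
    ← lintegral_add_left (by fun_prop)]
  refine lintegral_mono fun t ↦ ?_
  rw [mul_assoc, ofReal_exp_mul_exp, Pi.mul_apply]
  rcases le_total t T₀ with ht | ht
  · refine le_trans ?_ le_self_add
    rw [add_mul, ← ofReal_exp_mul_exp, ← mul_assoc, ← ENNReal.ofReal_mul' (Real.exp_nonneg _)]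
    gcongr
    exact hTA t ht
  · refine le_trans ?_ le_add_self
    gcongr
    have : (s - 2) * t ≤ (s - 2) * T₀ := mul_le_mul_of_nonpos_left ht (by linarith)
    linarith

/-- Splitting a Mellin transform at `Λ` and subtracting the polar part. -/
theorem mgf_withDensity_eq {S T : ℝ → ℝ≥0∞} (hS : Measurable S) (hT : Measurable T)
    {Λ κ A : ℝ} (hκ : 0 ≤ κ) (hA : 0 ≤ A)
    (hTS : ∀ t, T t + ENNReal.ofReal (A * Real.exp (-t)) = S t + ENNReal.ofReal κ)
    {s : ℝ} (hs : 1 < s) (h : ∫⁻ t, S t * ENNReal.ofReal (Real.exp (s * t)) ≠ ∞) :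
    mgf id ((volume.restrict (Set.Iic Λ)).withDensity T) s =
      (∫⁻ t, S t * ENNReal.ofReal (Real.exp (s * t))).toReal -
      mgf id ((volume.restrict (Set.Ioi Λ)).withDensity S) s +
      κ * Real.exp (s * Λ) / s - A * Real.exp ((s - 1) * Λ) / (s - 1) := by
  have h0 : 0 < s := by linarith
  have h1 : 0 < s - 1 := by linarith
  rw [mgf_id_eq_toReal, mgf_id_eq_toReal, lintegral_withDensity_eq_lintegral_mul _ hS (by fun_prop),
    lintegral_withDensity_eq_lintegral_mul _ hT (by fun_prop)]
  simp only [Pi.mul_apply]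
  have hsplit := lintegral_add_compl (μ := volume)
    (fun t ↦ S t * ENNReal.ofReal (Real.exp (s * t))) (measurableSet_Iic (a := Λ))
  rw [Set.compl_Iic] at hsplit
  have heq : (∫⁻ t in Set.Iic Λ, T t * ENNReal.ofReal (Real.exp (s * t))) +
      ENNReal.ofReal A * ENNReal.ofReal (Real.exp ((s - 1) * Λ) / (s - 1)) =
      (∫⁻ t in Set.Iic Λ, S t * ENNReal.ofReal (Real.exp (s * t))) +
      ENNReal.ofReal κ * ENNReal.ofReal (Real.exp (s * Λ) / s) := by
    rw [← lintegral_Iic_ofReal_exp h0, ← lintegral_Iic_ofReal_exp h1,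
      ← lintegral_const_mul _ (by fun_prop), ← lintegral_const_mul _ (by fun_prop),
      ← lintegral_add_right _ (by fun_prop), ← lintegral_add_right _ (by fun_prop)]
    refine lintegral_congr fun t ↦ ?_
    rw [← add_mul, ← hTS, add_mul, ENNReal.ofReal_mul hA, mul_assoc (ENNReal.ofReal A),
      ofReal_exp_mul_exp]
    ring_nf
  rw [← hsplit] at h ⊢
  obtain ⟨hf1, hf2⟩ := ENNReal.add_ne_top.mp h
  rw [← ENNReal.ofReal_mul hA, ← ENNReal.ofReal_mul hκ] at heq
  have hf3 : ∫⁻ t in Set.Iic Λ, T t * ENNReal.ofReal (Real.exp (s * t)) ≠ ∞ :=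
    ne_top_of_le_ne_top (ENNReal.add_ne_top.mpr ⟨hf1, ENNReal.ofReal_ne_top⟩)
      (le_self_add.trans heq.le)
  have := congrArg ENNReal.toReal heq
  rw [ENNReal.toReal_add hf3 ENNReal.ofReal_ne_top, ENNReal.toReal_add hf1 ENNReal.ofReal_ne_top,
    ENNReal.toReal_ofReal (by positivity), ENNReal.toReal_ofReal (by positivity)] at this
  rw [ENNReal.toReal_add hf1 hf2, mul_div_assoc, mul_div_assoc]
  linarith

end Landau

section Landau

open ProbabilityTheory

/-- Landau's positivity argument: if the Mellin transform `Z` of `S` has only a simple pole at `1`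
in the right half plane, then the tail of its defining integral at `1 / 2` is controlled by
`Z (1 / 2)`. -/
theorem lintegral_Ioi_le_of_differentiableAt {S : ℝ → ℝ≥0∞} (hS : Measurable S)
    {Λ κ A T₀ C δ : ℝ} (hκ : 0 ≤ κ) (hA : 0 ≤ A) (hC : 0 ≤ C) (hδ : 0 < δ) (hΛ : Λ ≤ 0)
    (hlow : ∀ t, ENNReal.ofReal (A * Real.exp (-t)) ≤ S t + ENNReal.ofReal κ)
    (hup : ∀ t ≤ T₀, S t + ENNReal.ofReal κ ≤
      ENNReal.ofReal (A * Real.exp (-t) * (1 + C * Real.exp (δ * t))))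
    {Z : ℂ → ℂ} (hZ : ∀ s : ℂ, 0 < s.re → s ≠ 1 → DifferentiableAt ℂ Z s)
    (hfin : ∀ s : ℝ, 1 < s → ∫⁻ t, S t * ENNReal.ofReal (Real.exp (s * t)) ≠ ∞)
    (hZS : ∀ s : ℝ, 1 < s →
      Z s = ((∫⁻ t, S t * ENNReal.ofReal (Real.exp (s * t))).toReal : ℂ)) :
    ∫⁻ t in Set.Ioi Λ, S t * ENNReal.ofReal (Real.exp (1 / 2 * t)) ≠ ∞ ∧
    ((∫⁻ t in Set.Ioi Λ, S t * ENNReal.ofReal (Real.exp (1 / 2 * t))).toReal : ℂ) ≤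
      Z (1 / 2) + ((2 * κ * Real.exp (Λ / 2) + 2 * A * Real.exp (-Λ / 2) : ℝ) : ℂ) := by
  set T : ℝ → ℝ≥0∞ := fun t ↦ S t + ENNReal.ofReal κ - ENNReal.ofReal (A * Real.exp (-t)) with hTdef
  have hT : Measurable T := by fun_prop
  have hTS (t : ℝ) : T t + ENNReal.ofReal (A * Real.exp (-t)) = S t + ENNReal.ofReal κ :=
    tsub_add_cancel_of_le (hlow t)
  have hTA (t : ℝ) (ht : t ≤ T₀) :
      T t ≤ ENNReal.ofReal (A * C * Real.exp ((δ - 1) * t)) := by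
    refine tsub_le_iff_left.mpr ((hup t ht).trans ?_)
    rw [← ENNReal.ofReal_add (by positivity) (by positivity)]
    refine ENNReal.ofReal_le_ofReal (le_of_eq ?_)
    rw [show (δ - 1) * t = -t + δ * t by ring, Real.exp_add]
    ring
  set ν₁ := (volume.restrict (Set.Iic Λ)).withDensity T with hν₁
  set ν₂ := (volume.restrict (Set.Ioi Λ)).withDensity S with hν₂
  have hmem₁ {s : ℝ} (hs : 1 - δ < s) : s ∈ interior (integrableExpSet id ν₁) :=
    interior_maximal (fun x (hx : 1 - δ < x) ↦ mem_integrableExpSet_withDensity_Iic hT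
      (fun t ↦ le_self_add.trans (hTS t).le) hTA hfin hx) isOpen_Ioi hs
  have huniv : integrableExpSet id ν₂ = Set.univ :=
    Set.eq_univ_of_forall (mem_integrableExpSet_withDensity_Ioi hS hfin)
  have han₂ (s : ℂ) : DifferentiableAt ℂ (complexMGF id ν₂) s :=
    (analyticAt_complexMGF (by simp [huniv])).differentiableAt
  set H₀ : ℂ → ℂ := fun s ↦ Z s - complexMGF id ν₂ s + κ * Complex.exp (s * Λ) / s -
    A * Complex.exp ((s - 1) * Λ) / (s - 1) with hH₀
  have hH₀d (s : ℂ) (hs : 0 < s.re) (hs1 : s ≠ 1) : DifferentiableAt ℂ H₀ s := by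
    have h0 : s ≠ 0 := by rintro rfl; simp at hs
    have h1 : s - 1 ≠ 0 := sub_ne_zero.mpr hs1
    have := hZ s hs hs1
    have := han₂ s
    fun_prop (disch := assumption)
  have hreal (s : ℝ) (hs : 1 < s) : H₀ s = complexMGF id ν₁ s := by
    rw [complexMGF_ofReal, mgf_withDensity_eq hS hT hκ hA hTS hs (hfin s hs), hH₀]
    simp only [complexMGF_ofReal, hZS s hs]
    push_cast
    rfl
  set r : ℝ := min δ 1 / 2 with hr
  have hr0 : 0 < r := by positivity
  have hrδ : r < δ := by have := min_le_left δ 1; linarith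
  have hr1 : r < 1 := by have := min_le_right δ 1; linarith
  have hre {s : ℂ} (hs : s ∈ Metric.ball (1 : ℂ) r) : 1 - r < s.re := by
    have := (Complex.abs_re_le_norm (s - 1)).trans_lt (by simpa [dist_eq_norm] using hs)
    have := (abs_lt.mp this).1
    simp at this
    linarith
  set c : ℝ := 1 + r / 2 with hc
  have hcmem : (c : ℂ) ∈ Metric.ball (1 : ℂ) r \ {1} := by
    constructor
    · rw [Metric.mem_ball, dist_eq_norm, hc]
      push_cast
      rw [add_sub_cancel_left, norm_div, Complex.norm_real, Real.norm_of_nonneg hr0.le]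
      simp
      linarith
    · simp only [Set.mem_singleton_iff]
      rw [← Complex.ofReal_one, Complex.ofReal_inj]
      linarith
  have hopen : IsOpen (Metric.ball (1 : ℂ) r \ {1}) := Metric.isOpen_ball.sdiff isClosed_singleton
  have hEq : Set.EqOn H₀ (complexMGF id ν₁) (Metric.ball (1 : ℂ) r \ {1}) := by
    refine AnalyticOnNhd.eqOn_of_preconnected_of_frequently_eq (z₀ := (c : ℂ)) ?_ ?_
      (isPreconnected_ball_diff_singleton 1 r) hcmem ?_
    · refine DifferentiableOn.analyticOnNhd (fun s hs ↦ ?_) hopen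
      exact (hH₀d s (by linarith [hre hs.1]) hs.2).differentiableWithinAt
    · exact fun s hs ↦ analyticAt_complexMGF (hmem₁ (by linarith [hre hs.1]))
    · have htend : Tendsto (fun x : ℝ ↦ (x : ℂ)) (𝓝[>] c) (𝓝[≠] (c : ℂ)) := by
        refine tendsto_nhdsWithin_iff.mpr
          ⟨Complex.continuous_ofReal.continuousAt.tendsto.mono_left nhdsWithin_le_nhds, ?_⟩
        filter_upwards [self_mem_nhdsWithin] with x (hx : c < x)
        simpa using hx.ne'
      refine htend.frequently (Eventually.frequently ?_)
      filter_upwards [self_mem_nhdsWithin] with x (hx : c < x)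
      exact hreal x (by linarith)
  set H : ℂ → ℂ := Function.update H₀ 1 (complexMGF id ν₁ 1) with hH
  have hHne {s : ℂ} (hs : s ≠ 1) : H s = H₀ s := Function.update_of_ne hs _ _
  have hHball : Set.EqOn H (complexMGF id ν₁) (Metric.ball 1 r) := by
    intro s hs
    rcases eq_or_ne s 1 with rfl | hs1
    · exact Function.update_self _ _ _
    · rw [hHne hs1]
      exact hEq ⟨hs, hs1⟩
  have hHd (s : ℂ) (hs : 0 < s.re) : DifferentiableAt ℂ H s := by
    rcases eq_or_ne s 1 with rfl | hs1
    · exact (analyticAt_complexMGF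
          (hmem₁ (by simpa using hδ))).differentiableAt.congr_of_eventuallyEq
        (hHball.eventuallyEq_of_mem (Metric.ball_mem_nhds _ hr0))
    · refine (hH₀d s hs hs1).congr_of_eventuallyEq ?_
      filter_upwards [isOpen_ne.mem_nhds hs1] with z hz using hHne hz
  have hc0 : 0 < c := by positivity
  have hnonneg : 0 ≤ H ((1 / 2 : ℝ) : ℂ) := by
    refine nonneg_of_eventuallyEq_complexMGF (ν := ν₁) (c := c) ?_ (hmem₁ (by linarith))
      (fun s hs ↦ ?_) (hHball.eventuallyEq_of_mem (Metric.isOpen_ball.mem_nhds hcmem.1))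
      (by norm_num) (by linarith)
    · refine (withDensity_absolutelyContinuous _ _).ae_le ?_
      filter_upwards [ae_restrict_mem measurableSet_Iic] with t ht using le_trans ht hΛ
    · refine (hHd s ?_).differentiableWithinAt
      have := (Complex.abs_re_le_norm (s - c)).trans_lt (by simpa [dist_eq_norm] using hs)
      have := (abs_lt.mp this).1
      simp at this
      linarith
  have hS12 : ∫⁻ t in Set.Ioi Λ, S t * ENNReal.ofReal (Real.exp (1 / 2 * t)) =
      ∫⁻ t, ENNReal.ofReal (Real.exp (1 / 2 * t)) ∂ν₂ := by
    rw [lintegral_withDensity_eq_lintegral_mul _ hS (by fun_prop)]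
    rfl
  refine ⟨?_, ?_⟩
  · rw [hS12]
    exact (mem_integrableExpSet_id_iff _ _).mp (huniv ▸ Set.mem_univ _)
  · rw [hS12, ← mgf_id_eq_toReal, ← complexMGF_ofReal, ← sub_nonneg]
    refine hnonneg.trans_eq ?_
    rw [hHne (by norm_num), hH₀]
    push_cast
    rw [show (1 / 2 : ℂ) * Λ = Λ / 2 by ring, show (1 / 2 - 1 : ℂ) * Λ = -Λ / 2 by ring]
    ring
end Landau

section IdealZeta

variable (L : Type*) [Field L] [NumberField L]

instance : Countable (Ideal (𝓞 L)) := by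
  have : ⋃ n : ℕ, {I : Ideal (𝓞 L) | Ideal.absNorm I = n} = Set.univ :=
    Set.eq_univ_of_forall fun I ↦ Set.mem_iUnion.mpr ⟨Ideal.absNorm I, rfl⟩
  rw [← Set.countable_univ_iff, ← this]
  exact Set.countable_iUnion fun n ↦ (Ideal.finite_setOfPred_absNorm_eq n).countable

/-- The Dedekind zeta series with values in `ℝ≥0∞`. -/
noncomputable def idealZeta (s : ℝ) : ℝ≥0∞ :=
  ∑' I : (Ideal (𝓞 L))⁰, ENNReal.ofReal ((Ideal.absNorm (I : Ideal (𝓞 L)) : ℝ) ^ (-s))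

theorem LSeriesSummable_card_absNorm {s : ℝ} (hs : 1 < s) :
    LSeriesSummable (fun n ↦ (Nat.card {I : Ideal (𝓞 L) // Ideal.absNorm I = n} : ℂ)) s := by
  have key := LSeriesSummable_of_sum_norm_bigO_and_nonneg
    (f := fun n ↦ (Nat.card {I : Ideal (𝓞 L) // Ideal.absNorm I = n} : ℝ)) (r := 1) (s := s) ?_
    (fun _ ↦ Nat.cast_nonneg _) zero_le_one (by simpa using hs)
  · simpa using key
  · have h := ((Ideal.tendsto_norm_le_div_atTop₀ L).comp tendsto_natCast_atTop_atTop)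
    have h2 := h.isBigO_one ℝ |>.mul (Asymptotics.isBigO_refl (fun n : ℕ ↦ (n : ℝ)) atTop)
    refine Asymptotics.IsBigO.congr' h2 ?_ ?_
    · filter_upwards [eventually_ne_atTop 0] with n hn
      have hn' : (n : ℝ) ≠ 0 := by exact_mod_cast hn
      rw [Function.comp_apply, div_mul_cancel₀ _ hn']
      simp only [Nat.cast_le, ← Nat.cast_sum]
      congr
      rw [← add_left_inj 1, ← Ideal.card_norm_le_eq_card_norm_le_add_one,
        show Finset.Icc 1 n = Finset.Ioc 0 n from Finset.Icc_succ_left_eq_Ioc _ _,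
        show 1 = Nat.card {I : Ideal (𝓞 L) // Ideal.absNorm I = 0} by
          simp [Ideal.absNorm_eq_zero_iff],
        Finset.sum_Ioc_add_eq_sum_Icc (n.zero_le),
        ← Finset.card_preimage_eq_sum_card_image_eq
          (fun k _ ↦ Ideal.finite_setOfPred_absNorm_eq k)]
      simp [Set.coe_eq_subtype]
    · filter_upwards with n using by simp

theorem idealZeta_eq_tsum (s : ℝ) :
    idealZeta L s = ∑' n : ℕ, ENNReal.ofReal ‖LSeries.term
      (fun n ↦ (Nat.card {I : Ideal (𝓞 L) // Ideal.absNorm I = n} : ℂ)) s n‖ := by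
  rw [idealZeta, ← (Equiv.sigmaFiberEquiv
    fun I : (Ideal (𝓞 L))⁰ ↦ Ideal.absNorm (I : Ideal (𝓞 L))).tsum_eq, ENNReal.tsum_sigma']
  refine tsum_congr fun n ↦ ?_
  have hterm (I : {I : (Ideal (𝓞 L))⁰ // Ideal.absNorm (I : Ideal (𝓞 L)) = n}) :
      ENNReal.ofReal ((Ideal.absNorm ((Equiv.sigmaFiberEquiv
        fun I : (Ideal (𝓞 L))⁰ ↦ Ideal.absNorm (I : Ideal (𝓞 L))) ⟨n, I⟩ : Ideal (𝓞 L)) : ℝ) ^ (-s))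
        = ENNReal.ofReal ((n : ℝ) ^ (-s)) := by
    rw [Equiv.sigmaFiberEquiv_apply, I.2]
  rw [tsum_congr hterm, LSeries.norm_term_eq]
  rcases eq_or_ne n 0 with rfl | hn
  · have : IsEmpty {I : (Ideal (𝓞 L))⁰ // Ideal.absNorm (I : Ideal (𝓞 L)) = 0} :=
      ⟨fun I ↦ Ideal.absNorm_ne_zero_of_nonZeroDivisors I.1 I.2⟩
    simp
  · have hmem {I : Ideal (𝓞 L)} (h : Ideal.absNorm I = n) : I ∈ (Ideal (𝓞 L))⁰ := by
      rw [mem_nonZeroDivisors_iff_ne_zero]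
      rintro rfl
      exact hn (by simpa using h.symm)
    have e : {I : (Ideal (𝓞 L))⁰ // Ideal.absNorm (I : Ideal (𝓞 L)) = n} ≃
        {I : Ideal (𝓞 L) // Ideal.absNorm I = n} := Equiv.subtypeSubtypeEquivSubtype hmem
    have : Finite {I : Ideal (𝓞 L) // Ideal.absNorm I = n} := Ideal.finite_setOfPred_absNorm_eq n
    rw [ENNReal.tsum_const, ENat.card_congr e, ENat.card_eq_coe_natCard, if_neg hn,
      Complex.norm_natCast, div_eq_mul_inv, ENNReal.ofReal_mul (by positivity),
      ENNReal.ofReal_natCast, Complex.ofReal_re, Real.rpow_neg (by positivity)]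
    rfl

variable {L}

theorem idealZeta_ne_top {s : ℝ} (hs : 1 < s) : idealZeta L s ≠ ∞ := by
  rw [idealZeta_eq_tsum]
  exact ((LSeriesSummable_card_absNorm L hs).norm).tsum_ofReal_ne_top

theorem toReal_idealZeta_eq_tsum (s : ℝ) : (idealZeta L s).toReal =
    ∑' I : (Ideal (𝓞 L))⁰, (Ideal.absNorm (I : Ideal (𝓞 L)) : ℝ) ^ (-s) := by
  rw [idealZeta, ENNReal.tsum_toReal_eq fun _ ↦ ENNReal.ofReal_ne_top]
  exact tsum_congr fun I ↦ ENNReal.toReal_ofReal (by positivity)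

theorem ofReal_toReal_idealZeta (s : ℝ) :
    ((idealZeta L s).toReal : ℂ) = dedekindZeta L s := by
  rw [idealZeta_eq_tsum, ENNReal.tsum_toReal_eq fun _ ↦ ENNReal.ofReal_ne_top, dedekindZeta,
    LSeries, Complex.ofReal_tsum]
  refine tsum_congr fun n ↦ ?_
  rw [ENNReal.toReal_ofReal (norm_nonneg _), LSeries.norm_term_eq, LSeries.term]
  split_ifs
  · simp
  · rw [Complex.norm_natCast, Complex.ofReal_re]
    push_cast
    rw [Complex.ofReal_cpow (by positivity)]
    simp

end IdealZeta

theorem toReal_idealZeta (L : Type) [Field L] [NumberField L] (s : ℝ) :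
    (idealZeta L s).toReal = zetaSeries L s := toReal_idealZeta_eq_tsum s

theorem zetaSeriesC_ofReal (L : Type) [Field L] [NumberField L] (s : ℝ) :
    zetaSeriesC L s = ((idealZeta L s).toReal : ℂ) := by
  rw [toReal_idealZeta, zetaSeriesC, zetaSeries, Complex.ofReal_tsum]
  refine tsum_congr fun I ↦ ?_
  rw [Complex.ofReal_cpow (by positivity)]
  simp

theorem tendsto_zetaSeries (L : Type) [Field L] [NumberField L] :
    Tendsto (fun s : ℝ ↦ (s - 1) * zetaSeries L s) (𝓝[>] 1) (𝓝 (dedekindZeta_residue L)) := by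
  have h := (Complex.continuous_re.tendsto _).comp (tendsto_sub_one_mul_dedekindZeta_nhdsGT L)
  rw [Complex.ofReal_re] at h
  refine h.congr' ?_
  filter_upwards with s
  rw [Function.comp_apply, ← ofReal_toReal_idealZeta, toReal_idealZeta, ← Complex.ofReal_one,
    ← Complex.ofReal_sub, ← Complex.ofReal_mul, Complex.ofReal_re]

section IdealSum

open NumberField.InfinitePlace NumberField.Units NumberField.Units.dirichletUnitTheorem
open scoped Classical

variable {L : Type*} [Field L] [NumberField L]

theorem card_ne_w₀_add_one : Fintype.card {w : InfinitePlace L // w ≠ w₀} + 1 =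
    Fintype.card (InfinitePlace L) := by
  have : 0 < Fintype.card (InfinitePlace L) := Fintype.card_pos
  rw [Fintype.card_subtype_compl, Fintype.card_subtype_eq]
  omega

theorem measurable_planeWeight (hL : ∀ w : InfinitePlace L, w.IsComplex) :
    Measurable (planeWeight L) :=
  planeWeight_of_isComplex hL ▸ measurable_simplexWeight

theorem measurable_idealSum (hL : ∀ w : InfinitePlace L, w.IsComplex) :
    Measurable (idealSum L) := by
  have := measurable_planeWeight hL
  unfold idealSum
  fun_prop

theorem lintegral_idealSum (hL : ∀ w : InfinitePlace L, w.IsComplex) {s : ℝ} (hs : 0 < s) :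
    ∫⁻ t, idealSum L t * ENNReal.ofReal (Real.exp (s * t)) =
      idealZeta L s * ENNReal.ofReal (Real.Gamma s ^ Fintype.card (InfinitePlace L)) := by
  have hm := measurable_planeWeight hL
  simp only [idealSum, idealZeta, ← ENNReal.tsum_mul_right]
  rw [lintegral_tsum fun I ↦ Measurable.aemeasurable (by fun_prop)]
  refine tsum_congr fun I ↦ ?_
  have hN : (0 : ℝ) < Ideal.absNorm (I : Ideal (𝓞 L)) := by
    have := Ideal.absNorm_ne_zero_of_nonZeroDivisors I
    positivity
  rw [← lintegral_sub_right_eq_self _ (Real.log (Ideal.absNorm (I : Ideal (𝓞 L))))]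
  have h (t : ℝ) : planeWeight L (t - Real.log (Ideal.absNorm (I : Ideal (𝓞 L))) +
      Real.log (Ideal.absNorm (I : Ideal (𝓞 L)))) *
      ENNReal.ofReal (Real.exp (s * (t - Real.log (Ideal.absNorm (I : Ideal (𝓞 L)))))) =
      ENNReal.ofReal ((Ideal.absNorm (I : Ideal (𝓞 L)) : ℝ) ^ (-s)) *
        (planeWeight L t * ENNReal.ofReal (Real.exp (s * t))) := by
    rw [sub_add_cancel, mul_left_comm, Real.rpow_def_of_pos hN, ofReal_exp_mul_exp]
    ring_nf
  have hm' : Measurable fun t ↦ planeWeight L t * ENNReal.ofReal (Real.exp (s * t)) :=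
    hm.mul (by fun_prop)
  rw [lintegral_congr h, lintegral_const_mul _ hm', planeWeight_of_isComplex hL, lintegral_simplexWeight hs,
    card_ne_w₀_add_one]

theorem ofReal_le_idealSum (hL : ∀ w : InfinitePlace L, w.IsReal) (t : ℝ) :
    ENNReal.ofReal (dedekindZeta_residue L / 2 ^ Module.finrank ℚ L *
      (Real.pi ^ ((Module.finrank ℚ L : ℝ) / 2) * Real.exp (-t) - √|(discr L : ℝ)|)) ≤
      idealSum L t := by
  have : IsTotallyReal L := ⟨hL⟩
  have hw : (0 : ℝ) < torsionOrder L := by exact_mod_cast torsionOrder_pos L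
  have hw' : (torsionOrder L : ℝ≥0∞) ≠ 0 := by exact_mod_cast (torsionOrder_pos L).ne'
  have hD : (0 : ℝ) < √|(discr L : ℝ)| :=
    Real.sqrt_pos_of_pos (abs_pos.mpr (by exact_mod_cast discr_ne_zero L))
  rw [← ENNReal.mul_le_mul_iff_right hw' (ENNReal.natCast_ne_top _)]
  have h := tsub_le_iff_left.mpr (le_idealSum (L := L) t)
  rw [← ENNReal.ofReal_sub _ (by have := regulator_pos L; positivity)] at h
  refine le_trans (le_of_eq ?_) h
  rw [← ENNReal.ofReal_natCast, ← ENNReal.ofReal_mul hw.le]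
  congr 1
  rw [dedekindZeta_residue_def, thetaConst, IsTotallyReal.nrComplexPlaces_eq_zero,
    ← IsTotallyReal.finrank]
  field_simp

end IdealSum

theorem Ideal.map_algebraMap_injective (F K : Type*) [Field F] [NumberField F] [Field K]
    [NumberField K] [Algebra F K] :
    Function.Injective (Ideal.map (algebraMap (𝓞 F) (𝓞 K))) := fun I J h ↦
  FractionalIdeal.coeIdeal_injective (K := F) <|
    FractionalIdeal.extendedHom_injective (A := 𝓞 F) (K := F) K (𝓞 K) <| by
      simp only [FractionalIdeal.extendedHom_coeIdeal_eq_map]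
      exact congrArg _ h

section Extension

open NumberField.InfinitePlace NumberField.Units NumberField.Units.dirichletUnitTheorem
open scoped Classical

variable {F K : Type*} [Field F] [NumberField F] [Field K] [NumberField K] [Algebra F K]

theorem card_infinitePlace_eq_of_isReal_of_isComplex (hF : ∀ v : InfinitePlace F, v.IsReal)
    (hK : ∀ w : InfinitePlace K, w.IsComplex) (hFK : Module.finrank F K = 2) :
    Fintype.card (InfinitePlace K) = Fintype.card (InfinitePlace F) := by
  have : IsTotallyReal F := ⟨hF⟩
  have : IsTotallyComplex K := ⟨hK⟩
  have h1 := Module.finrank_mul_finrank ℚ F K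
  rw [hFK, IsTotallyReal.finrank, IsTotallyComplex.finrank (K := K)] at h1
  rw [card_eq_nrRealPlaces_add_nrComplexPlaces, card_eq_nrRealPlaces_add_nrComplexPlaces,
    IsTotallyReal.nrComplexPlaces_eq_zero (K := F),
    IsTotallyComplex.nrRealPlaces_eq_zero (K := K)]
  omega

theorem le_idealSum_of_isReal_of_isComplex (hF : ∀ v : InfinitePlace F, v.IsReal)
    (hK : ∀ w : InfinitePlace K, w.IsComplex) (hFK : Module.finrank F K = 2) (t : ℝ) :
    2 ^ Units.rank F * idealSum F (t / 2) ≤ idealSum K t := by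
  have e : {w : InfinitePlace K // w ≠ w₀} ≃ {v : InfinitePlace F // v ≠ w₀} := by
    refine Fintype.equivOfCardEq ?_
    have := card_infinitePlace_eq_of_isReal_of_isComplex hF hK hFK
    rwa [← card_ne_w₀_add_one, ← card_ne_w₀_add_one, add_left_inj] at this
  have hinj : Function.Injective (ClassGroup.extendedIdeal (𝓞 F) (𝓞 K)) := fun I J h ↦
    Subtype.ext <| Ideal.map_algebraMap_injective F K <| congrArg Subtype.val h
  rw [idealSum, idealSum, ← ENNReal.tsum_mul_left]
  refine le_trans (ENNReal.tsum_le_tsum fun I ↦ le_of_eq ?_)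
    (ENNReal.tsum_comp_le_tsum_of_injective hinj _)
  rw [← planeWeight_of_isReal hF, planeWeight_of_isComplex hK, simplexWeight_congr e,
    Ideal.absNorm_algebraMap, ← IsFractionRing.finrank_eq (𝓞 F) F (𝓞 K) K, hFK]
  push_cast
  rw [Real.log_pow]
  congr 1
  push_cast
  ring

theorem ofReal_le_idealSum_of_isReal_of_isComplex (hF : ∀ v : InfinitePlace F, v.IsReal)
    (hK : ∀ w : InfinitePlace K, w.IsComplex) (hFK : Module.finrank F K = 2) (t : ℝ) :
    ENNReal.ofReal (dedekindZeta_residue F / 2 *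
      (Real.pi ^ ((Module.finrank ℚ F : ℝ) / 2) * Real.exp (-t / 2) - √|(discr F : ℝ)|)) ≤
      idealSum K t := by
  have : IsTotallyReal F := ⟨hF⟩
  refine le_trans ?_ (le_idealSum_of_isReal_of_isComplex hF hK hFK t)
  refine le_trans (le_of_eq ?_) (mul_le_mul_right (ofReal_le_idealSum hF (t / 2)) _)
  have hn : Module.finrank ℚ F = Units.rank F + 1 := by
    have : 0 < Fintype.card (InfinitePlace F) := Fintype.card_pos
    have h := card_eq_nrRealPlaces_add_nrComplexPlaces F
    rw [IsTotallyReal.nrComplexPlaces_eq_zero] at h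
    rw [IsTotallyReal.finrank, Units.rank]
    omega
  have h2 : (2 : ℝ≥0∞) ^ Units.rank F = ENNReal.ofReal (2 ^ Units.rank F) := by
    rw [ENNReal.ofReal_pow zero_le_two, ENNReal.ofReal_ofNat]
  rw [h2, ← ENNReal.ofReal_mul (by positivity)]
  congr 1
  rw [← mul_assoc]
  congr 1
  · rw [hn, pow_succ]
    field_simp
  · ring_nf

end Extension

section TotallyComplex

open NumberField.InfinitePlace NumberField.Units

theorem lintegral_idealSum_le {K : Type} [Field K] [NumberField K]
    (hK : ∀ w : InfinitePlace K, w.IsComplex) {zetaK : ℂ → ℂ}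
    (hz : ∀ s : ℂ, 1 < s.re → zetaK s = zetaSeriesC K s)
    (hd : ∀ s : ℂ, s ≠ 1 → DifferentiableAt ℂ zetaK s) {x : ℝ} (hx : zetaK (1 / 2) ≤ x)
    {Λ : ℝ} (hΛ : Λ ≤ 0) :
    ∫⁻ t in Set.Ioi Λ, idealSum K t * ENNReal.ofReal (Real.exp (1 / 2 * t)) ≠ ∞ ∧
    (∫⁻ t in Set.Ioi Λ, idealSum K t * ENNReal.ofReal (Real.exp (1 / 2 * t))).toReal ≤
      x * √Real.pi ^ Fintype.card (InfinitePlace K) +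
      2 * (classNumber K * regulator K / torsionOrder K) *
        (Real.exp (Λ / 2) + thetaConst K * Real.exp (-Λ / 2)) := by
  have hw : (0 : ℝ) < torsionOrder K := by exact_mod_cast torsionOrder_pos K
  have hw' : (torsionOrder K : ℝ≥0∞) ≠ 0 := by exact_mod_cast (torsionOrder_pos K).ne'
  have hR := regulator_pos K
  have hP := thetaConst_pos (L := K)
  have hn : (0 : ℝ) < Module.finrank ℚ K := by exact_mod_cast Module.finrank_pos
  set κ : ℝ := classNumber K * regulator K / torsionOrder K with hκdef
  have hκ : 0 ≤ κ := by positivity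
  have hκw : (classNumber K * regulator K : ℝ) = torsionOrder K * κ := by
    rw [hκdef]; field_simp
  obtain ⟨C, hC0, hC⟩ := exists_idealSum_le (L := K)
  have hE (t : ℝ) : ENNReal.ofReal (classNumber K * regulator K) + torsionOrder K * idealSum K t =
      torsionOrder K * (idealSum K t + ENNReal.ofReal κ) := by
    rw [hκw, ENNReal.ofReal_mul hw.le, ENNReal.ofReal_natCast, mul_add, add_comm]
  have hlow (t : ℝ) : ENNReal.ofReal (κ * thetaConst K * Real.exp (-t)) ≤
      idealSum K t + ENNReal.ofReal κ := by
    rw [← ENNReal.mul_le_mul_iff_right hw' (ENNReal.natCast_ne_top _), ← hE,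
      ← ENNReal.ofReal_natCast, ← ENNReal.ofReal_mul hw.le, ENNReal.ofReal_natCast]
    refine le_trans (le_of_eq ?_) (le_idealSum (L := K) t)
    rw [hκw]
    ring_nf
  have hup (t : ℝ) (ht : t ≤ Module.finrank ℚ K * Real.log (1 / 2)) :
      idealSum K t + ENNReal.ofReal κ ≤ ENNReal.ofReal (κ * thetaConst K * Real.exp (-t) *
        (1 + C * Real.exp ((Module.finrank ℚ K : ℝ)⁻¹ * t))) := by
    rw [← ENNReal.mul_le_mul_iff_right hw' (ENNReal.natCast_ne_top _), ← hE]
    refine (hC t ?_).trans (le_of_eq ?_)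
    · rw [← Real.le_log_iff_exp_le (by norm_num), div_le_iff₀' hn]
      exact ht
    · rw [← ENNReal.ofReal_natCast, ← ENNReal.ofReal_mul hw.le, hκw]
      ring_nf
  have hmellin (s : ℝ) (hs : 1 < s) := lintegral_idealSum hK (zero_lt_one.trans hs)
  obtain ⟨hfin, hle⟩ := lintegral_Ioi_le_of_differentiableAt (measurable_idealSum hK) hκ
    (mul_nonneg hκ hP.le) hC0 (inv_pos.mpr hn) hΛ hlow hup
    (Z := fun s ↦ zetaK s * Complex.Gamma s ^ Fintype.card (InfinitePlace K))
    (fun s hs hs1 ↦ (hd s hs1).mul ((Complex.differentiableAt_Gamma s fun m h ↦ by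
      simp [h] at hs; linarith [(m.cast_nonneg : (0 : ℝ) ≤ m)]).pow _))
    (fun s hs ↦ by
      rw [hmellin s hs]
      exact ENNReal.mul_ne_top (idealZeta_ne_top hs) ENNReal.ofReal_ne_top)
    (fun s hs ↦ by
      rw [hmellin s hs, hz s (by simpa using hs), zetaSeriesC_ofReal, ENNReal.toReal_mul,
        ENNReal.toReal_ofReal (pow_nonneg (Real.Gamma_nonneg_of_nonneg (by linarith)) _),
        Complex.Gamma_ofReal]
      push_cast
      rfl)
  refine ⟨hfin, ?_⟩
  have hG : Complex.Gamma (1 / 2) = ((√Real.pi : ℝ) : ℂ) := by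
    rw [← Real.Gamma_one_half_eq, ← Complex.Gamma_ofReal]
    norm_num
  have hpow : (0 : ℂ) ≤ ((√Real.pi : ℝ) : ℂ) ^ Fintype.card (InfinitePlace K) := by
    rw [← Complex.ofReal_pow, Complex.zero_le_real]
    positivity
  rw [hG] at hle
  have := hle.trans (add_le_add_left (mul_le_mul_of_nonneg_right hx hpow) _)
  rw [← Complex.ofReal_pow, ← Complex.ofReal_mul, ← Complex.ofReal_add,
    Complex.real_le_real] at this
  refine this.trans (le_of_eq ?_)
  ring

/-- The key inequality for the class number of `K`, before the analytic input is combined with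
the class number formulas. -/
theorem residue_mul_le {F K : Type} [Field F] [NumberField F] [Field K] [NumberField K]
    [Algebra F K] (hF : ∀ v : InfinitePlace F, v.IsReal)
    (hK : ∀ w : InfinitePlace K, w.IsComplex) (hFK : Module.finrank F K = 2) {zetaK : ℂ → ℂ}
    (hz : ∀ s : ℂ, 1 < s.re → zetaK s = zetaSeriesC K s)
    (hd : ∀ s : ℂ, s ≠ 1 → DifferentiableAt ℂ zetaK s) {x : ℝ} (hx : zetaK (1 / 2) ≤ x)
    (hdisc : |(discr F : ℝ)| ^ 2 ≤ |(discr K : ℝ)|) :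
    dedekindZeta_residue F / 2 * (√Real.pi ^ Module.finrank ℚ F *
      (Real.log (|(discr K : ℝ)| / |(discr F : ℝ)| ^ 2) / 2) - 2) ≤
    x * √Real.pi ^ Module.finrank ℚ F + 2 * (classNumber K * regulator K / torsionOrder K) *
      |(discr K : ℝ)| ^ (-(1 / 4) : ℝ) * (1 + (2 * Real.pi) ^ Module.finrank ℚ F) := by
  have : IsTotallyReal F := ⟨hF⟩
  have : IsTotallyComplex K := ⟨hK⟩
  have hn : Module.finrank ℚ F = Fintype.card (InfinitePlace K) := by
    rw [card_infinitePlace_eq_of_isReal_of_isComplex hF hK hFK, IsTotallyReal.finrank,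
      card_eq_nrRealPlaces_add_nrComplexPlaces, IsTotallyReal.nrComplexPlaces_eq_zero, add_zero]
  have hn2 : nrComplexPlaces K = Module.finrank ℚ F := by
    rw [hn, card_eq_nrRealPlaces_add_nrComplexPlaces, IsTotallyComplex.nrRealPlaces_eq_zero,
      zero_add]
  have hdF : (1 : ℝ) ≤ |(discr F : ℝ)| := by
    exact_mod_cast Int.one_le_abs (discr_ne_zero F)
  have hdK : (1 : ℝ) ≤ |(discr K : ℝ)| := by
    exact_mod_cast Int.one_le_abs (discr_ne_zero K)
  set n := Module.finrank ℚ F with hndef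
  set dF := |(discr F : ℝ)| with hdFdef
  set dK := |(discr K : ℝ)| with hdKdef
  have hdF0 : 0 < dF := by linarith
  have hdK0 : 0 < dK := by linarith
  have hρ := dedekindZeta_residue_pos F
  have hlog : Real.log (dK / dF ^ 2) = Real.log dK - 2 * Real.log dF := by
    rw [Real.log_div hdK0.ne' (by positivity), Real.log_pow]; norm_num
  have hlog0 : 0 ≤ Real.log (dK / dF ^ 2) := Real.log_nonneg (by
    rw [one_le_div (by positivity)]; exact hdisc)
  set Λ₀ : ℝ := -(Real.log dK / 2) with hΛ₀
  set Λ₁ : ℝ := -Real.log dF with hΛ₁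
  have hΛ : Λ₀ ≤ Λ₁ := by linarith
  have hΛ₀' : Λ₀ ≤ 0 := by have := Real.log_nonneg hdK; linarith
  obtain ⟨hfin, hle⟩ := lintegral_idealSum_le hK hz hd hx hΛ₀'
  have hexp0 : Real.exp (Λ₀ / 2) = dK ^ (-(1 / 4) : ℝ) := by
    rw [Real.rpow_def_of_pos hdK0, hΛ₀]; ring_nf
  have hθ : thetaConst K * Real.exp (-Λ₀ / 2) = dK ^ (-(1 / 4) : ℝ) * (2 * Real.pi) ^ n := by
    have h1 : Real.exp (-Λ₀ / 2) / √dK = dK ^ (-(1 / 4) : ℝ) := by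
      rw [Real.sqrt_eq_rpow, Real.rpow_def_of_pos hdK0, Real.rpow_def_of_pos hdK0, ← Real.exp_sub,
        hΛ₀]
      ring_nf
    have h2 : (Module.finrank ℚ K : ℝ) / 2 = n := by
      rw [IsTotallyComplex.finrank (K := K), hn2]; push_cast; ring
    rw [← h1, thetaConst, ← hdKdef, h2, hn2, Real.rpow_natCast, mul_pow]
    ring
  rw [hexp0, hθ, ← hn] at hle
  refine le_trans ?_ (hle.trans (le_of_eq (by ring)))
  set g : ℝ → ℝ := fun t ↦ dedekindZeta_residue F / 2 * (√Real.pi ^ n - √dF * Real.exp (t / 2))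
    with hg
  have hgle (t : ℝ) : ENNReal.ofReal (g t) ≤
      idealSum K t * ENNReal.ofReal (Real.exp (1 / 2 * t)) := by
    refine le_trans (le_of_eq ?_)
      (mul_le_mul_left (ofReal_le_idealSum_of_isReal_of_isComplex hF hK hFK t) _)
    rw [← ENNReal.ofReal_mul' (Real.exp_nonneg _), hg, Real.sqrt_eq_rpow Real.pi,
      ← Real.rpow_mul_natCast Real.pi_pos.le, show (1 / 2 * n : ℝ) = n / 2 by ring,
      show (1 / 2 * t : ℝ) = t / 2 by ring]
    congr 1
    rw [mul_assoc, sub_mul, mul_assoc _ (Real.exp (-t / 2)), ← Real.exp_add, neg_div,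
      neg_add_cancel, Real.exp_zero, mul_one]
  have hgc : Continuous g := by fun_prop
  have hgi : IntegrableOn g (Set.Ioc Λ₀ Λ₁) := hgc.integrableOn_Ioc
  have hint : ∫ t in Set.Ioc Λ₀ Λ₁, g t ≤
      (∫⁻ t in Set.Ioi Λ₀, idealSum K t * ENNReal.ofReal (Real.exp (1 / 2 * t))).toReal := by
    rw [integral_eq_lintegral_pos_part_sub_lintegral_neg_part hgi]
    refine (sub_le_self _ ENNReal.toReal_nonneg).trans (ENNReal.toReal_mono hfin ?_)
    exact (lintegral_mono hgle).trans (lintegral_mono_set Set.Ioc_subset_Ioi_self)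
  refine le_trans ?_ hint
  have hval : ∫ t in Set.Ioc Λ₀ Λ₁, g t = dedekindZeta_residue F / 2 *
      (√Real.pi ^ n * (Λ₁ - Λ₀) - √dF * (2 * (Real.exp (Λ₁ / 2) - Real.exp (Λ₀ / 2)))) := by
    rw [← intervalIntegral.integral_of_le hΛ, hg, intervalIntegral.integral_const_mul,
      intervalIntegral.integral_sub (by simp) (Continuous.intervalIntegrable (by fun_prop) _ _),
      intervalIntegral.integral_const, intervalIntegral.integral_const_mul,
      intervalIntegral.integral_comp_div _ two_ne_zero, integral_exp]
    simp [mul_comm]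
  rw [hval]
  have hexp1 : √dF * Real.exp (Λ₁ / 2) = 1 := by
    rw [Real.sqrt_eq_rpow, Real.rpow_def_of_pos hdF0, ← Real.exp_add, hΛ₁, Real.exp_eq_one_iff]
    ring
  have hexp2 : 0 ≤ √dF * Real.exp (Λ₀ / 2) := by positivity
  gcongr
  · rw [hlog]
    linarith
  · linarith

end TotallyComplex

theorem IsCyclic.isSquare_mul_of_not_isSquare {G : Type*} [CommGroup G] [IsCyclic G] {a b : G}
    (ha : ¬ IsSquare a) (hb : ¬ IsSquare b) : IsSquare (a * b) := by
  obtain ⟨g, hg⟩ := IsCyclic.exists_generator (α := G)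
  obtain ⟨i, rfl⟩ := Subgroup.mem_zpowers_iff.mp (hg a)
  obtain ⟨j, rfl⟩ := Subgroup.mem_zpowers_iff.mp (hg b)
  have hi : Odd i := Int.not_even_iff_odd.mp fun h ↦ ha (h.isSquare_zpow g)
  have hj : Odd j := Int.not_even_iff_odd.mp fun h ↦ hb (h.isSquare_zpow g)
  rw [← zpow_add]
  exact (hi.add_odd hj).isSquare_zpow g

theorem NumberField.Units.torsionOrder_le (F K : Type*) [Field F] [NumberField F] [Field K]
    [NumberField K] [Algebra F K] : torsionOrder F ≤ torsionOrder K := by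
  refine Nat.card_le_card_of_injective (fun ζ ↦ (⟨Units.map (algebraMap (𝓞 F) (𝓞 K)).toMonoidHom ζ,
    MonoidHom.isOfFinOrder _ ζ.2⟩ : torsion K)) fun a b h ↦ Subtype.ext ?_
  exact Units.map_injective (FaithfulSMul.algebraMap_injective (𝓞 F) (𝓞 K))
    (congrArg Subtype.val h)

section CMField

open NumberField.InfinitePlace NumberField.Units NumberField.IsCMField

variable {K : Type*} [Field K] [NumberField K] [IsCMField K]

theorem exists_torsion_mul_complexConj {I : Ideal (𝓞 (maximalRealSubfield K))} {α : 𝓞 K}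
    (hI : I.map (algebraMap (𝓞 (maximalRealSubfield K)) (𝓞 K)) = Ideal.span {α}) :
    ∃ ζ : torsion K, α = ((ζ : (𝓞 K)ˣ) : 𝓞 K) * ringOfIntegersComplexConj K α := by
  by_cases hα : α = 0
  · exact ⟨1, by simp [hα]⟩
  let σ : 𝓞 K →+* 𝓞 K := RingHomClass.toRingHom (ringOfIntegersComplexConj K)
  have h : Ideal.span {σ α} = Ideal.span {α} := by
    rw [← hI, ← Set.image_singleton, ← Ideal.map_span, ← hI, Ideal.map_map]
    congr 1
    ext x
    simp [σ]
  obtain ⟨u, hu⟩ := Ideal.span_singleton_eq_span_singleton.mp h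
  refine ⟨⟨u, (mem_torsion K).mpr fun w ↦ ?_⟩, by rw [mul_comm]; exact hu.symm⟩
  have h1 := congrArg (fun x : 𝓞 K ↦ w (x : K)) hu
  have h2 : w (α : K) ≠ 0 := by simpa using hα
  have h3 : w (σ α : K) = w α := infinitePlace_complexConj K w α
  simpa [h3, h2] using h1

theorem isPrincipal_of_eq_sq_mul_complexConj {I : Ideal (𝓞 (maximalRealSubfield K))} {α : 𝓞 K}
    (hI : I.map (algebraMap (𝓞 (maximalRealSubfield K)) (𝓞 K)) = Ideal.span {α}) {ζ : torsion K}
    (hζ : IsSquare ζ) (h : α = ((ζ : (𝓞 K)ˣ) : 𝓞 K) * ringOfIntegersComplexConj K α) :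
    I.IsPrincipal := by
  obtain ⟨ξ, rfl⟩ := hζ
  have hξ : ringOfIntegersComplexConj K ((ξ⁻¹ : torsion K) : (𝓞 K)ˣ) = ((ξ : (𝓞 K)ˣ) : 𝓞 K) := by
    have := congrArg (fun u : (𝓞 K)ˣ ↦ (u : 𝓞 K)) (unitsComplexConj_torsion K ξ⁻¹)
    exact this.trans (by simp)
  have h1 : ringOfIntegersComplexConj K (((ξ⁻¹ : torsion K) : (𝓞 K)ˣ) * α) =
      ((ξ⁻¹ : torsion K) : (𝓞 K)ˣ) * α := by
    rw [map_mul, hξ]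
    nth_rewrite 2 [h]
    simp [← mul_assoc]
  obtain ⟨β, hβ⟩ := (ringOfIntegersComplexConj_eq_self_iff K _).mp h1
  refine ⟨β, Ideal.map_algebraMap_injective _ K ?_⟩
  rw [hI, Ideal.submodule_span_eq, Ideal.map_span, Set.image_singleton, hβ,
    Ideal.span_singleton_eq_span_singleton]
  exact (associated_unit_mul_left _ _ (Units.isUnit _)).symm

theorem card_ker_extendedHom_le_two :
    Nat.card (ClassGroup.extendedHom (𝓞 (maximalRealSubfield K)) (𝓞 K)).ker ≤ 2 := by
  have key {c d : ClassGroup (𝓞 (maximalRealSubfield K))}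
      (hc : ClassGroup.extendedHom _ (𝓞 K) c = 1) (hd : ClassGroup.extendedHom _ (𝓞 K) d = 1)
      (hc1 : c ≠ 1) (hd1 : d ≠ 1) : c * d = 1 := by
    obtain ⟨I, rfl⟩ := ClassGroup.mk0_surjective c
    obtain ⟨J, rfl⟩ := ClassGroup.mk0_surjective d
    rw [ClassGroup.extendedHom_mk0, ClassGroup.mk0_eq_one_iff] at hc hd
    rw [Ne, ClassGroup.mk0_eq_one_iff] at hc1 hd1
    rw [← map_mul, ClassGroup.mk0_eq_one_iff]
    obtain ⟨α, hα⟩ := hc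
    obtain ⟨β, hβ⟩ := hd
    obtain ⟨ζ, hζ⟩ := exists_torsion_mul_complexConj hα
    obtain ⟨ξ, hξ⟩ := exists_torsion_mul_complexConj hβ
    refine isPrincipal_of_eq_sq_mul_complexConj (α := α * β) (ζ := ζ * ξ) ?_
      (IsCyclic.isSquare_mul_of_not_isSquare
        (fun h ↦ hc1 (isPrincipal_of_eq_sq_mul_complexConj hα h hζ))
        (fun h ↦ hd1 (isPrincipal_of_eq_sq_mul_complexConj hβ h hξ))) ?_
    · rw [Submonoid.coe_mul, Ideal.map_mul, ← Ideal.span_singleton_mul_span_singleton]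
      exact congrArg₂ _ hα hβ
    · rw [map_mul]
      nth_rewrite 1 [hζ, hξ]
      push_cast
      ring
  have key' {c d : (ClassGroup.extendedHom (𝓞 (maximalRealSubfield K)) (𝓞 K)).ker}
      (hc : c ≠ 1) (hd : d ≠ 1) : c = d := by
    have h (x y : (ClassGroup.extendedHom (𝓞 (maximalRealSubfield K)) (𝓞 K)).ker) (hx : x ≠ 1)
        (hy : y ≠ 1) : x * y = 1 :=
      Subtype.ext <| key x.2 y.2 (by simpa using hx) (by simpa using hy)
    exact mul_right_cancel ((h c d hc hd).trans (h d d hd hd).symm)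
  by_contra! hlt
  obtain ⟨a, b, hab, ha, hb⟩ : ∃ a b : (ClassGroup.extendedHom (𝓞 (maximalRealSubfield K))
      (𝓞 K)).ker, a ≠ b ∧ a ≠ 1 ∧ b ≠ 1 := by
    have := Fintype.ofFinite (ClassGroup.extendedHom (𝓞 (maximalRealSubfield K)) (𝓞 K)).ker
    rw [Nat.card_eq_fintype_card] at hlt
    obtain ⟨a, b, c, hab, hac, hbc⟩ := Fintype.two_lt_card_iff.mp hlt
    by_cases ha : a = 1
    · exact ⟨b, c, hbc, ha ▸ hab.symm, ha ▸ hac.symm⟩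
    by_cases hb : b = 1
    · exact ⟨a, c, hac, ha, hb ▸ hbc.symm⟩
    exact ⟨a, b, hab, ha, hb⟩
  exact hab (key' ha hb)

variable (K) in
theorem classNumber_maximalRealSubfield_le :
    classNumber (maximalRealSubfield K) ≤ 2 * classNumber K := by
  have h := Subgroup.card_mul_index (ClassGroup.extendedHom (𝓞 (maximalRealSubfield K)) (𝓞 K)).ker
  rw [Subgroup.index_ker] at h
  rw [classNumber, classNumber, ← Nat.card_eq_fintype_card, ← Nat.card_eq_fintype_card, ← h]
  exact Nat.mul_le_mul card_ker_extendedHom_le_two (Nat.card_le_card_of_injective _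
    Subtype.val_injective)

theorem classNumber_mul_regulator_div_torsionOrder_le :
    classNumber K * regulator K / torsionOrder K ≤
      (classNumber K / classNumber (maximalRealSubfield K) : ℝ) *
        (dedekindZeta_residue (maximalRealSubfield K) *
          √|(discr (maximalRealSubfield K) : ℝ)| / 2) := by
  set F := maximalRealSubfield K
  have hD : (0 : ℝ) < √|(discr F : ℝ)| :=
    Real.sqrt_pos_of_pos (abs_pos.mpr (by exact_mod_cast discr_ne_zero F))
  have hR := regulator_pos F
  have hhF : (0 : ℝ) < classNumber F := by exact_mod_cast classNumber_pos F
  have hhK : (0 : ℝ) < classNumber K := by exact_mod_cast classNumber_pos K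
  have hwF : (0 : ℝ) < torsionOrder F := by exact_mod_cast torsionOrder_pos F
  have hw : (torsionOrder F : ℝ) ≤ torsionOrder K := by
    exact_mod_cast torsionOrder_le F K
  have hn : nrRealPlaces F = Units.rank F + 1 := by
    have : 0 < Fintype.card (InfinitePlace F) := Fintype.card_pos
    have h := card_eq_nrRealPlaces_add_nrComplexPlaces F
    rw [IsTotallyReal.nrComplexPlaces_eq_zero] at h
    rw [Units.rank]
    omega
  have hreg : regulator K ≤ 2 ^ Units.rank F * regulator F := by
    have h := regulator_div_regulator_eq_two_pow_mul_indexRealUnits_inv K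
    rw [← units_rank_eq_units_rank K] at h
    rw [← div_le_iff₀ hR, h]
    refine mul_le_of_le_one_right (by positivity) (inv_le_one_of_one_le₀ ?_)
    rcases indexRealUnits_eq_one_or_two K with h | h <;> simp [h]
  rw [dedekindZeta_residue_def, IsTotallyReal.nrComplexPlaces_eq_zero, hn]
  calc _ ≤ classNumber K * (2 ^ Units.rank F * regulator F) / torsionOrder F := by gcongr
    _ = _ := by
      rw [pow_succ]
      field_simp

end CMField

section RingEquiv

variable {L L' : Type*} [Field L] [NumberField L] [Field L'] [NumberField L']

theorem NumberField.dedekindZeta_eq_of_ringEquiv (e : L ≃+* L') :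
    dedekindZeta L = dedekindZeta L' := by
  have hN (I : Ideal (𝓞 L')) : Ideal.absNorm (I.comap (RingOfIntegers.mapRingEquiv e)) =
      Ideal.absNorm I := by
    rw [Ideal.absNorm_apply, Ideal.absNorm_apply, Submodule.cardQuot_apply,
      Submodule.cardQuot_apply]
    exact Nat.card_congr (Ideal.quotientEquiv _ _ (RingOfIntegers.mapRingEquiv e)
      (Ideal.map_comap_of_surjective _ (RingOfIntegers.mapRingEquiv e).surjective I).symm).toEquiv
  ext s
  unfold dedekindZeta
  congr 1
  ext n
  congr 1
  exact Nat.card_congr ((RingOfIntegers.mapRingEquiv e).idealComapOrderIso.toEquiv.subtypeEquiv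
    fun I ↦ by rw [← hN I]; rfl).symm

theorem NumberField.dedekindZeta_residue_eq_of_ringEquiv (e : L ≃+* L') :
    dedekindZeta_residue L = dedekindZeta_residue L' := by
  have h := tendsto_sub_one_mul_dedekindZeta_nhdsGT L
  rw [dedekindZeta_eq_of_ringEquiv e] at h
  exact_mod_cast tendsto_nhds_unique h (tendsto_sub_one_mul_dedekindZeta_nhdsGT L')

theorem NumberField.classNumber_eq_of_ringEquiv (e : L ≃+* L') :
    classNumber L = classNumber L' :=
  Fintype.card_congr (ClassGroup.mulEquiv (RingOfIntegers.mapRingEquiv e)).toEquiv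

end RingEquiv

section TotallyReal

open NumberField.InfinitePlace NumberField.Units

variable {F K : Type*} [Field F] [NumberField F] [Field K] [NumberField K] [Algebra F K]

theorem classNumber_le_of_isReal_of_isComplex (hF : ∀ v : InfinitePlace F, v.IsReal)
    (hK : ∀ w : InfinitePlace K, w.IsComplex) (hFK : Module.finrank F K = 2) :
    classNumber F ≤ 2 * classNumber K := by
  have : IsTotallyReal F := ⟨hF⟩
  have : IsTotallyComplex K := ⟨hK⟩
  have : Algebra.IsQuadraticExtension F K := ⟨hFK⟩
  have := IsCMField.ofCMExtension F K
  rw [classNumber_eq_of_ringEquiv (CMExtension.equivMaximalRealSubfield F K)]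
  exact classNumber_maximalRealSubfield_le K

theorem classNumber_mul_regulator_div_torsionOrder_le_of_isReal_of_isComplex
    (hF : ∀ v : InfinitePlace F, v.IsReal) (hK : ∀ w : InfinitePlace K, w.IsComplex)
    (hFK : Module.finrank F K = 2) :
    classNumber K * regulator K / torsionOrder K ≤ (classNumber K / classNumber F : ℝ) *
      (dedekindZeta_residue F * √|(discr F : ℝ)| / 2) := by
  have : IsTotallyReal F := ⟨hF⟩
  have : IsTotallyComplex K := ⟨hK⟩
  have : Algebra.IsQuadraticExtension F K := ⟨hFK⟩
  have := IsCMField.ofCMExtension F K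
  have e := CMExtension.equivMaximalRealSubfield F K
  rw [classNumber_eq_of_ringEquiv e, dedekindZeta_residue_eq_of_ringEquiv e,
    discr_eq_discr_of_ringEquiv F e]
  exact classNumber_mul_regulator_div_torsionOrder_le

end TotallyReal

section RelativeClassNumber

theorem NumberField.one_add_two_pi_pow_le (F : Type*) [Field F] [NumberField F] :
    1 + (2 * Real.pi) ^ Module.finrank ℚ F ≤ 23 * |(discr F : ℝ)| ^ 3 := by
  have hd : (1 : ℝ) ≤ |(discr F : ℝ)| := by
    exact_mod_cast Int.one_le_abs (discr_ne_zero F)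
  have h3 := Real.pi_gt_three
  have h4 := Real.pi_lt_d2
  have hpos : 0 < Module.finrank ℚ F := Module.finrank_pos
  have h1 : 1 ≤ (2 * Real.pi) ^ Module.finrank ℚ F := one_le_pow₀ (by linarith)
  have h2 : (2 * Real.pi) ^ Module.finrank ℚ F ≤ (9 / 4 * |(discr F : ℝ)|) ^ 3 := by
    rcases Nat.eq_or_lt_of_le hpos with hn | hn
    · calc (2 * Real.pi) ^ Module.finrank ℚ F = 2 * Real.pi := by rw [← hn, Nat.succ_eq_add_one,
            zero_add, pow_one]
        _ ≤ (9 / 4 * 1) ^ 3 := by linarith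
        _ ≤ _ := by gcongr
    · have h := abs_discr_ge hn
      rw [Int.cast_abs] at h
      calc (2 * Real.pi) ^ Module.finrank ℚ F
          ≤ ((3 * Real.pi / 4) ^ 3) ^ Module.finrank ℚ F := by
            gcongr
            nlinarith [mul_pos (sub_pos.mpr h3) (sub_pos.mpr h3)]
        _ = ((3 * Real.pi / 4) ^ Module.finrank ℚ F) ^ 3 := pow_right_comm _ _ _
        _ ≤ _ := by
            gcongr
            linarith
  have h5 := pow_nonneg (abs_nonneg (discr F : ℝ)) 3
  rw [mul_pow (9 / 4)] at h2
  linarith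

theorem relativeClassNumber_ge {F K : Type} [Field F] [NumberField F] [Field K] [NumberField K]
    [Algebra F K] (hF : ∀ v : InfinitePlace F, v.IsReal) (hK : ∀ w : InfinitePlace K, w.IsComplex)
    (hFK : Module.finrank F K = 2) {zetaK : ℂ → ℂ}
    (hz : ∀ s : ℂ, 1 < s.re → zetaK s = zetaSeriesC K s)
    (hd : ∀ s : ℂ, s ≠ 1 → DifferentiableAt ℂ zetaK s)
    (hD : |(discr F : ℝ)| ^ 2 < |(discr K : ℝ)|)
    (hx : zetaK (1 / 2) ≤ ((dedekindZeta_residue F *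
      Real.log (|(discr K : ℝ)| / |(discr F : ℝ)| ^ 2) / 8 : ℝ) : ℂ)) :
    1 / 3000 * |(discr F : ℝ)| ^ (-4 : ℝ) * |(discr K : ℝ)| ^ (1 / 4 : ℝ) *
      Real.log (|(discr K : ℝ)| / |(discr F : ℝ)| ^ 2) ≤ (classNumber K : ℝ) / classNumber F := by
  have hmain := residue_mul_le hF hK hFK hz hd hx hD.le
  have hκ := classNumber_mul_regulator_div_torsionOrder_le_of_isReal_of_isComplex hF hK hFK
  have hC := one_add_two_pi_pow_le F
  have hC0 : 0 ≤ 1 + (2 * Real.pi) ^ Module.finrank ℚ F := by positivity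
  have hh : (classNumber F : ℝ) ≤ 2 * classNumber K := by
    exact_mod_cast classNumber_le_of_isReal_of_isComplex hF hK hFK
  have hhF : (0 : ℝ) < classNumber F := by exact_mod_cast classNumber_pos F
  have hρ := dedekindZeta_residue_pos F
  have hd1 : (1 : ℝ) ≤ |(discr F : ℝ)| := by
    exact_mod_cast Int.one_le_abs (discr_ne_zero F)
  have hPi : 1 ≤ √Real.pi ^ Module.finrank ℚ F :=
    one_le_pow₀ (Real.one_le_sqrt.mpr (by linarith [Real.pi_gt_three]))
  have hh2 : (1 : ℝ) / 2 ≤ classNumber K / classNumber F := by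
    rw [div_le_div_iff₀ two_pos hhF]
    linarith
  generalize hdef : (classNumber K : ℝ) / classNumber F = h at *
  generalize √Real.pi ^ Module.finrank ℚ F = P at *
  generalize 1 + (2 * Real.pi) ^ Module.finrank ℚ F = C at *
  generalize (classNumber K : ℝ) * Units.regulator K / Units.torsionOrder K = κ at *
  generalize dedekindZeta_residue F = ρ at *
  generalize |(discr F : ℝ)| = d at *
  generalize |(discr K : ℝ)| = D at *
  have hd0 : 0 < d := by linarith
  have hD0 : 0 < D := lt_trans (by positivity) hD
  have hL : 0 < Real.log (D / d ^ 2) := Real.log_pos ((one_lt_div (by positivity)).mpr hD)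
  have hDL : D = d ^ 2 * Real.exp (Real.log (D / d ^ 2)) := by
    rw [Real.exp_log (by positivity)]
    field_simp
  generalize Real.log (D / d ^ 2) = L at *
  have hd4 : d ^ (-4 : ℝ) = (d ^ 4)⁻¹ := by
    rw [Real.rpow_neg hd0.le]
    norm_cast
  have hE : 0 < D ^ (1 / 4 : ℝ) := by positivity
  have hE' : D ^ (-(1 / 4) : ℝ) = (D ^ (1 / 4 : ℝ))⁻¹ := Real.rpow_neg hD0.le _
  rw [hd4]
  rw [hE'] at hmain
  rcases le_or_gt 16 L with h16 | h16
  · have hsq : √d ≤ d := Real.sqrt_le_self_iff.mpr (.inr hd1)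
    generalize D ^ (1 / 4 : ℝ) = E at *
    have h1 : P * L / 8 - 1 ≤ h * √d * E⁻¹ * C := by
      refine le_of_mul_le_mul_left ?_ hρ
      have : 2 * κ * E⁻¹ * C ≤ 2 * (h * (ρ * √d / 2)) * E⁻¹ * C := by gcongr
      linarith
    have h2 : L / 16 ≤ h * d * E⁻¹ * (23 * d ^ 3) := by
      calc L / 16 ≤ P * L / 8 - 1 := by nlinarith
        _ ≤ _ := h1
        _ ≤ _ := by gcongr
    have h3 : L / 16 * E ≤ 23 * h * d ^ 4 := by
      calc L / 16 * E ≤ h * d * E⁻¹ * (23 * d ^ 3) * E := by gcongr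
        _ = _ := by field_simp
    calc 1 / 3000 * (d ^ 4)⁻¹ * E * L ≤ 1 / 368 * (d ^ 4)⁻¹ * E * L := by gcongr; norm_num
      _ = (L / 16 * E) / (23 * d ^ 4) := by field_simp; norm_num
      _ ≤ h := by rw [div_le_iff₀ (by positivity)]; linarith
  · have he : Real.exp 4 < 81 := by
      calc Real.exp 4 = Real.exp 1 ^ 4 := by rw [← Real.exp_nat_mul]; norm_num
        _ < 3 ^ 4 := by gcongr; exact Real.exp_one_lt_three
        _ = 81 := by norm_num
    have h1 : D ^ (1 / 4 : ℝ) ≤ d ^ 4 * 81 := by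
      calc D ^ (1 / 4 : ℝ) ≤ ((d ^ 4 * 81) ^ 4) ^ (1 / 4 : ℝ) := by
            refine Real.rpow_le_rpow hD0.le ?_ (by norm_num)
            have : Real.exp L ≤ 81 ^ 4 := by
              calc Real.exp L ≤ Real.exp 16 := Real.exp_le_exp.mpr h16.le
                _ = Real.exp 4 ^ 4 := by rw [← Real.exp_nat_mul]; norm_num
                _ ≤ 81 ^ 4 := by gcongr
            calc D = d ^ 2 * Real.exp L := hDL
              _ ≤ d ^ 16 * 81 ^ 4 := by gcongr; norm_num
              _ = _ := by ring
        _ = d ^ 4 * 81 := by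
            rw [← Real.rpow_natCast, ← Real.rpow_mul (by positivity)]
            norm_num
    calc 1 / 3000 * (d ^ 4)⁻¹ * D ^ (1 / 4 : ℝ) * L ≤
        1 / 3000 * (d ^ 4)⁻¹ * (d ^ 4 * 81) * 16 := by gcongr
      _ = 1 / 3000 * 81 * 16 := by field_simp
      _ ≤ 1 / 2 := by norm_num
      _ ≤ h := hh2

end RelativeClassNumber

end Auxiliary

/-- there are absolute constants `c₁, c₂ > 0` such that for every CM extension
`K/F` with `ζ_K(1/2) ≤ ρ_F/(4[𝓞_K^×:𝓞_F^×]h_F) log(√D_K/D_F)` one has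
`h_K^- ≥ c₁ D_F^{-c₂} D_K^{1/4} log D_{K/F}` where `h_K^- = h_K/h_F` and
`D_{K/F} = D_K D_F^{-2}`. -/
theorem stmt1 :
    ∃ c₁ c₂ : ℝ, 0 < c₁ ∧ 0 < c₂ ∧
      ∀ (F K : Type) [Field F] [NumberField F] [Field K] [NumberField K] [Algebra F K],
      (∀ v : InfinitePlace F, v.IsReal) →
      (∀ w : InfinitePlace K, w.IsComplex) →
      Module.finrank F K = 2 →
      ∀ (ρF : ℝ),
      Tendsto (fun s : ℝ => (s - 1) * zetaSeries F s) (𝓝[>] 1) (𝓝 ρF) →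
      ∀ (zetaK : ℂ → ℂ),
      (∀ s : ℂ, 1 < s.re → zetaK s = zetaSeriesC K s) →
      (∀ s : ℂ, s ≠ 1 → DifferentiableAt ℂ zetaK s) →
      zetaK (1 / 2) ≤
        ((ρF / (4 * (unitIndex F K : ℝ) * (classNumber F : ℝ)) *
          Real.log (Real.sqrt ((discr K).natAbs) / ((discr F).natAbs : ℝ)) : ℝ) : ℂ) →
      (classNumber K : ℝ) / (classNumber F : ℝ) ≥
        c₁ * ((discr F).natAbs : ℝ) ^ (-c₂) *
          ((discr K).natAbs : ℝ) ^ ((1 : ℝ) / 4) *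
          Real.log (((discr K).natAbs : ℝ) / ((discr F).natAbs : ℝ) ^ (2 : ℕ)) := by
  refine ⟨1 / 3000, 4, by norm_num, by norm_num, ?_⟩
  intro F K _ _ _ _ _ hF hK hFK ρF hρF zetaK hz hd hx
  obtain rfl := tendsto_nhds_unique hρF (tendsto_zetaSeries F)
  have hQ (L : Type) [Field L] [NumberField L] : ((discr L).natAbs : ℝ) = |(discr L : ℝ)| := by
    rw [Nat.cast_natAbs, Int.cast_abs]
  rw [hQ, hQ] at hx ⊢
  have hdF : 0 < |(discr F : ℝ)| := abs_pos.mpr (by exact_mod_cast discr_ne_zero F)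
  have hdK : 0 < |(discr K : ℝ)| := abs_pos.mpr (by exact_mod_cast discr_ne_zero K)
  rcases le_or_gt |(discr K : ℝ)| (|(discr F : ℝ)| ^ 2) with hD | hD
  · have hL : Real.log (|(discr K : ℝ)| / |(discr F : ℝ)| ^ 2) ≤ 0 :=
      Real.log_nonpos (by positivity) (div_le_one_of_le₀ hD (by positivity))
    exact (mul_nonpos_of_nonneg_of_nonpos (by positivity) hL).trans (by positivity)
  · refine relativeClassNumber_ge hF hK hFK hz hd hD (hx.trans ?_)
    have hL : 0 < Real.log (|(discr K : ℝ)| / |(discr F : ℝ)| ^ 2) :=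
      Real.log_pos ((one_lt_div (by positivity)).mpr hD)
    have hL' : Real.log (√|(discr K : ℝ)| / |(discr F : ℝ)|) =
        Real.log (|(discr K : ℝ)| / |(discr F : ℝ)| ^ 2) / 2 := by
      rw [← Real.log_sqrt (by positivity), Real.sqrt_div hdK.le, Real.sqrt_sq hdF.le]
    have hρ := dedekindZeta_residue_pos F
    have hle : dedekindZeta_residue F / (4 * (unitIndex F K : ℝ) * (classNumber F : ℝ)) ≤
        dedekindZeta_residue F / 4 := by
      rcases Nat.eq_zero_or_pos (unitIndex F K) with h0 | h0
      · rw [h0]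
        simp only [Nat.cast_zero, mul_zero, zero_mul, div_zero]
        positivity
      · have h1 : (1 : ℝ) ≤ unitIndex F K := by exact_mod_cast h0
        have h2 : (1 : ℝ) ≤ classNumber F := by exact_mod_cast classNumber_pos F
        refine div_le_div_of_nonneg_left hρ.le (by norm_num) ?_
        nlinarith
    rw [Complex.real_le_real, hL']
    calc _ ≤ dedekindZeta_residue F / 4 *
          (Real.log (|(discr K : ℝ)| / |(discr F : ℝ)| ^ 2) / 2) := by gcongr
      _ = _ := by ring
end

section
/- Let K/F be a finite extension of number fields, 𝔞 and 𝔟 fractional ideals of O_F, and α, β ∈ K^×. Suppose a ∈ 𝔞, b ∈ 𝔟, c ∈ 𝔟^{−1}, d ∈ 𝔞^{−1} are elements of F with ad − bc = 1. Set α′ = aα + bβ and β′ = cα + dβ. Then 𝔞·α + 𝔟·β = O_F·α′ + 𝔞𝔟·β′ as O_F-submodules of K. -/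
open NumberField
open scoped NumberField nonZeroDivisors

theorem FractionalIdeal.mul_inv_le_one {R K : Type*} [CommRing R] [IsDomain R] [Field K]
    [Algebra R K] [IsFractionRing R K] (I : FractionalIdeal R⁰ K) : I * I⁻¹ ≤ 1 := by
  rw [FractionalIdeal.inv_eq]
  exact FractionalIdeal.mul_one_div_le_one

/-- if `a ∈ 𝔞`, `b ∈ 𝔟`, `c ∈ 𝔟⁻¹`, `d ∈ 𝔞⁻¹` with `ad - bc = 1`, and
`α' = aα + bβ`, `β' = cα + dβ`, then `𝔞·α + 𝔟·β = 𝓞_F·α' + 𝔞𝔟·β'` inside `K`. -/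
theorem stmt5
    (F K : Type) [Field F] [NumberField F] [Field K] [NumberField K] [Algebra F K]
    (𝔞 𝔟 : FractionalIdeal (𝓞 F)⁰ F) (α β : K) (hα : α ≠ 0) (hβ : β ≠ 0)
    (a b c d : F) (ha : a ∈ 𝔞) (hb : b ∈ 𝔟) (hc : c ∈ 𝔟⁻¹) (hd : d ∈ 𝔞⁻¹)
    (hdet : a * d - b * c = 1) :
    ∀ u : K,
      (∃ x y : F, x ∈ 𝔞 ∧ y ∈ 𝔟 ∧
          u = algebraMap F K x * α + algebraMap F K y * β) ↔
      (∃ (x : 𝓞 F) (y : F), y ∈ 𝔞 * 𝔟 ∧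
          u = algebraMap F K (algebraMap (𝓞 F) F x) *
                (algebraMap F K a * α + algebraMap F K b * β)
            + algebraMap F K y *
                (algebraMap F K c * α + algebraMap F K d * β)) := by
  have mem_ring {I : FractionalIdeal (𝓞 F)⁰ F} {x y : F} (hx : x ∈ I) (hy : y ∈ I⁻¹) :
      x * y ∈ (1 : FractionalIdeal (𝓞 F)⁰ F) :=
    I.mul_inv_le_one (FractionalIdeal.mul_mem_mul hx hy)
  have mem_left {I J : FractionalIdeal (𝓞 F)⁰ F} {y z : F} (hy : y ∈ I * J) (hz : z ∈ J⁻¹) :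
      y * z ∈ I := by
    have h : I * J * J⁻¹ ≤ I := by
      rw [mul_assoc]
      exact (mul_le_mul_right J.mul_inv_le_one I).trans_eq (mul_one I)
    exact h (FractionalIdeal.mul_mem_mul hy hz)
  have smul_mem {I : FractionalIdeal (𝓞 F)⁰ F} (x : 𝓞 F) {y : F} (hy : y ∈ I) :
      algebraMap (𝓞 F) F x * y ∈ I := by
    rw [← Algebra.smul_def]
    exact Submodule.smul_mem (I : Submodule (𝓞 F) F) x hy
  have hdet' : algebraMap F K a * algebraMap F K d - algebraMap F K b * algebraMap F K c = 1 := by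
    rw [← map_mul, ← map_mul, ← map_sub, hdet, map_one]
  intro u
  constructor
  · rintro ⟨x, y, hx, hy, rfl⟩
    obtain ⟨r, hr⟩ := (FractionalIdeal.mem_one_iff _).1
      (Submodule.sub_mem ((1 : FractionalIdeal (𝓞 F)⁰ F) : Submodule (𝓞 F) F)
        (mem_ring hx hd) (mem_ring hy hc))
    refine ⟨r, a * y - x * b, Submodule.sub_mem ((𝔞 * 𝔟 : FractionalIdeal (𝓞 F)⁰ F) :
      Submodule (𝓞 F) F) (FractionalIdeal.mul_mem_mul ha hy)
        (FractionalIdeal.mul_mem_mul hx hb), ?_⟩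
    rw [hr]
    simp only [map_sub, map_mul]
    linear_combination (-(algebraMap F K x * α + algebraMap F K y * β)) * hdet'
  · rintro ⟨r, y, hy, rfl⟩
    refine ⟨algebraMap (𝓞 F) F r * a + y * c, algebraMap (𝓞 F) F r * b + y * d,
      Submodule.add_mem (𝔞 : Submodule (𝓞 F) F) (smul_mem r ha) (mem_left hy hc),
      Submodule.add_mem (𝔟 : Submodule (𝓞 F) F) (smul_mem r hb)
        (mem_left (mul_comm 𝔞 𝔟 ▸ hy) hd), ?_⟩
    simp only [map_add, map_mul]
    ring
end

section
/- Let 𝔞 be a fractional ideal of K with decomposition 𝔞 = O_F·α ⊕ f_𝔞·β and CM point z_𝔞 = α/β satisfying Φ(z_𝔞) ∈ ℍ^n. Then the fractional O_K-ideal O_F·z_𝔞 + f_𝔞 satisfies N_{K/ℚ}(O_F·z_𝔞 + f_𝔞) = N_Φ(y_𝔞) · N_{F/ℚ}(f_𝔞) · 2^n · D_F / √D_K. -/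
open NumberField
open scoped NumberField nonZeroDivisors

/-- A CM type `Φ` of `K`. -/
def IsCMType (K : Type) [Field K] (Φ : Finset (K →+* ℂ)) : Prop :=
  ∀ φ : K →+* ℂ, φ ∈ Φ ↔ ((starRingEnd ℂ).comp φ) ∉ Φ

/-- The decomposition `𝔞 = 𝓞_F·α ⊕ f·β` of a fractional ideal `𝔞` of `K`. -/
def IsDecomposition (F K : Type) [Field F] [NumberField F] [Field K] [NumberField K]
    [Algebra F K] (𝔞 : FractionalIdeal (𝓞 K)⁰ K) (f : Ideal (𝓞 F)) (α β : K) : Prop :=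
  ∀ x : K, x ∈ 𝔞 ↔ ∃! p : (𝓞 F) × F,
    p.2 ∈ (f : FractionalIdeal (𝓞 F)⁰ F) ∧
    x = algebraMap F K (algebraMap (𝓞 F) F p.1) * α + algebraMap F K p.2 * β

namespace NumberField

open Module Matrix

/-- The square of the determinant of the conjugates of a `ℤ`-basis of a fractional ideal. -/
theorem det_embeddings_sq {L : Type*} [Field L] [NumberField L] {ι : Type*} [Fintype ι]
    [DecidableEq ι] (I : FractionalIdeal (𝓞 L)⁰ L) (bI : Basis ι ℤ I) (e : ι ≃ (L →+* ℂ)) :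
    (Matrix.of fun i j => e j (bI i : L)).det ^ 2 =
      ((FractionalIdeal.absNorm I : ℚ) : ℂ) ^ 2 * (discr L : ℂ) := by
  have hcard : Fintype.card (Free.ChooseBasisIndex ℤ (𝓞 L)) = Fintype.card ι := by
    rw [Fintype.card_congr e, Embeddings.card, ← finrank_eq_card_chooseBasisIndex,
      RingOfIntegers.rank]
  let b : Basis ι ℤ (𝓞 L) := (RingOfIntegers.basis L).reindex (Fintype.equivOfCardEq hcard)
  let b₀ : Basis ι ℚ L := b.localizationLocalization ℚ ℤ⁰ L
  let v : ι → L := fun i => (bI i : L)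
  have hdisc : Algebra.discr ℚ b₀ = discr L := by
    rw [← discr_eq_discr L b]
    exact Algebra.discr_localizationLocalization ℤ _ L b
  have hv : Algebra.discr ℚ v = (FractionalIdeal.absNorm I) ^ 2 * (discr L : ℚ) := by
    rw [← hdisc, ← FractionalIdeal.abs_det_basis_change b I bI, sq_abs, Basis.det_apply,
      ← Algebra.discr_of_matrix_vecMul, Basis.toMatrix_map_vecMul]
    rfl
  have h := Algebra.discr_eq_det_embeddingsMatrixReindex_pow_two ℚ ℂ v
    (e.trans (RingHom.equivRatAlgHom L ℂ))
  rw [hv] at h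
  have hM : Algebra.embeddingsMatrixReindex ℚ ℂ v (e.trans (RingHom.equivRatAlgHom L ℂ)) =
      Matrix.of fun i j => e j (bI i : L) := by
    ext i j
    simp [Algebra.embeddingsMatrixReindex, v]
  rw [← hM, ← h]
  simp

/-- The absolute value of the determinant of the conjugates of a `ℤ`-basis of a fractional
ideal. -/
theorem norm_det_embeddings {L : Type*} [Field L] [NumberField L] {ι : Type*} [Fintype ι]
    [DecidableEq ι] (I : FractionalIdeal (𝓞 L)⁰ L) (bI : Basis ι ℤ I) (e : ι ≃ (L →+* ℂ)) :
    ‖(Matrix.of fun i j => e j (bI i : L)).det‖ =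
      (FractionalIdeal.absNorm I : ℝ) * √((discr L).natAbs : ℝ) := by
  have hN : (0 : ℝ) ≤ FractionalIdeal.absNorm I := by
    exact_mod_cast FractionalIdeal.absNorm_nonneg I
  rw [← sq_eq_sq₀ (norm_nonneg _) (by positivity), mul_pow, Real.sq_sqrt (by positivity),
    ← norm_pow, det_embeddings_sq, norm_mul, norm_pow, Complex.norm_ratCast, sq_abs,
    Complex.norm_intCast, Nat.cast_natAbs, Int.cast_abs]

end NumberField

/-- The determinant of a matrix obtained by pairing the conjugates of `x i * z` and `y i`. -/
theorem Matrix.det_fromBlocks_mul_diagonal {ι R : Type*} [Fintype ι] [DecidableEq ι] [CommRing R]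
    (A B : Matrix ι ι R) (d d' : ι → R) :
    (Matrix.fromBlocks (A * Matrix.diagonal d) (A * Matrix.diagonal d') B B).det =
      A.det * B.det * ∏ i, (d i - d' i) := by
  have h : Matrix.fromBlocks (A * Matrix.diagonal d) (A * Matrix.diagonal d') B B =
      Matrix.fromBlocks A 0 0 B *
        Matrix.fromBlocks (Matrix.diagonal d) (Matrix.diagonal d') 1 1 := by
    simp [Matrix.fromBlocks_multiply]
  rw [h, Matrix.det_mul, Matrix.det_fromBlocks_zero₂₁, Matrix.det_fromBlocks_one₂₂, Matrix.mul_one,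
    Matrix.diagonal_sub, Matrix.det_diagonal]

namespace IsCMType

variable {K : Type} [Field K] {Φ : Finset (K →+* ℂ)}

theorem conj_mem (hΦ : IsCMType K Φ) {φ : K →+* ℂ} (h : φ ∉ Φ) :
    (starRingEnd ℂ).comp φ ∈ Φ := by
  by_contra h'
  exact h ((hΦ φ).2 h')

/-- The embeddings of `K` are those of a CM type together with their conjugates. -/
noncomputable def sumEquiv (hΦ : IsCMType K Φ) : Φ ⊕ Φ ≃ (K →+* ℂ) :=
  Equiv.ofBijective (Sum.elim (fun φ => φ.1) fun φ => (starRingEnd ℂ).comp φ.1) <| by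
    have hinv : ∀ φ : K →+* ℂ, (starRingEnd ℂ).comp ((starRingEnd ℂ).comp φ) = φ := fun φ => by
      ext x; simp
    constructor
    · refine Function.Injective.sumElim Subtype.val_injective ?_ ?_
      · intro φ ψ h
        have := congrArg (fun χ : K →+* ℂ => (starRingEnd ℂ).comp χ) h
        simp only [hinv] at this
        exact Subtype.ext this
      · intro φ ψ h
        exact (hΦ ψ).1 ψ.2 (h ▸ φ.2)
    · intro φ
      by_cases h : φ ∈ Φ
      · exact ⟨.inl ⟨φ, h⟩, rfl⟩
      · exact ⟨.inr ⟨_, hΦ.conj_mem h⟩, hinv φ⟩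

theorem sumEquiv_inl (hΦ : IsCMType K Φ) (φ : Φ) : hΦ.sumEquiv (.inl φ) = φ.1 := rfl

theorem sumEquiv_inr (hΦ : IsCMType K Φ) (φ : Φ) :
    hΦ.sumEquiv (.inr φ) = (starRingEnd ℂ).comp φ.1 := rfl

theorem two_mul_card [NumberField K] (hΦ : IsCMType K Φ) :
    2 * Fintype.card Φ = Module.finrank ℚ K := by
  rw [← NumberField.Embeddings.card K ℂ, ← Fintype.card_congr hΦ.sumEquiv, Fintype.card_sum,
    two_mul]

variable {F : Type} [Field F] [NumberField F] [NumberField K] [Algebra F K]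

/-- Restriction to the totally real subfield identifies a CM type with the embeddings of `F`. -/
noncomputable def restrictEquiv (hΦ : IsCMType K Φ)
    (hFreal : ∀ v : InfinitePlace F, v.IsReal) (hdeg : Module.finrank F K = 2) :
    Φ ≃ (F →+* ℂ) :=
  Equiv.ofBijective (fun φ => φ.1.comp (algebraMap F K)) <| by
    rw [Fintype.bijective_iff_surjective_and_card]
    constructor
    · intro σ
      have hσ : (starRingEnd ℂ).comp σ = σ :=
        ComplexEmbedding.isReal_iff.mp (InfinitePlace.isReal_mk_iff.mp (hFreal (.mk σ)))
      have hlift : (ComplexEmbedding.lift K σ).comp (algebraMap F K) = σ := by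
        ext x; simp
      by_cases h : ComplexEmbedding.lift K σ ∈ Φ
      · exact ⟨⟨_, h⟩, hlift⟩
      · refine ⟨⟨_, hΦ.conj_mem h⟩, ?_⟩
        simp only [RingHom.comp_assoc, hlift, hσ]
    · have := Module.finrank_mul_finrank ℚ F K
      have := hΦ.two_mul_card
      rw [NumberField.Embeddings.card]
      rw [hdeg] at *
      lia

theorem restrictEquiv_apply (hΦ : IsCMType K Φ)
    (hFreal : ∀ v : InfinitePlace F, v.IsReal) (hdeg : Module.finrank F K = 2) (φ : Φ) :
    hΦ.restrictEquiv hFreal hdeg φ = φ.1.comp (algebraMap F K) := rfl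

end IsCMType

/-- The isomorphism `(u, t) ↦ u * z + t` from `I × J` to a fractional ideal of `K` equal to
`I·z + J`, where `I` and `J` are fractional ideals of `F` and `z ∉ F`. -/
noncomputable def FractionalIdeal.prodEquivOfMemIff {F K : Type*} [Field F] [NumberField F]
    [Field K] [NumberField K] [Algebra F K] (I J : FractionalIdeal (𝓞 F)⁰ F)
    (𝔠 : FractionalIdeal (𝓞 K)⁰ K) (z : K) (hz : ∀ x : F, algebraMap F K x ≠ z)
    (h𝔠 : ∀ w : K, w ∈ 𝔠 ↔ ∃ u ∈ I, ∃ t ∈ J, w = algebraMap F K u * z + algebraMap F K t) :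
    (I × J) ≃ₗ[ℤ] (𝔠 : Submodule (𝓞 K) K) :=
  (AddEquiv.ofBijective
    (AddMonoidHom.mk' (fun p : I × J => (⟨algebraMap F K p.1 * z + algebraMap F K p.2,
      (h𝔠 _).2 ⟨p.1, p.1.2, p.2, p.2.2, rfl⟩⟩ :
      (𝔠 : Submodule (𝓞 K) K))) (by
        rintro ⟨u, t⟩ ⟨u', t'⟩
        ext
        simp only [Prod.mk_add_mk, Submodule.coe_add, map_add]
        ring)) (by
    constructor
    · rw [injective_iff_map_eq_zero]
      rintro ⟨⟨u, hu⟩, ⟨t, ht⟩⟩ h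
      have h' : algebraMap F K u * z + algebraMap F K t = 0 := congrArg Subtype.val h
      have hu0 : u = 0 := by
        by_contra hne
        have hne' : algebraMap F K u ≠ 0 := by simpa using hne
        refine hz (-t / u) ?_
        rw [map_div₀, map_neg, div_eq_iff hne']
        linear_combination -h'
      subst hu0
      have ht0 : t = 0 := by simpa using h'
      subst ht0
      rfl
    · rintro ⟨w, hw⟩
      obtain ⟨u, hu, t, ht, rfl⟩ := (h𝔠 w).1 hw
      exact ⟨⟨⟨u, hu⟩, ⟨t, ht⟩⟩, rfl⟩)).toIntLinearEquiv

theorem FractionalIdeal.coe_prodEquivOfMemIff {F K : Type*} [Field F] [NumberField F]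
    [Field K] [NumberField K] [Algebra F K] (I J : FractionalIdeal (𝓞 F)⁰ F)
    (𝔠 : FractionalIdeal (𝓞 K)⁰ K) (z : K) (hz : ∀ x : F, algebraMap F K x ≠ z)
    (h𝔠 : ∀ w : K, w ∈ 𝔠 ↔ ∃ u ∈ I, ∃ t ∈ J, w = algebraMap F K u * z + algebraMap F K t)
    (p : I × J) :
    (FractionalIdeal.prodEquivOfMemIff I J 𝔠 z hz h𝔠 p : K) =
      algebraMap F K p.1 * z + algebraMap F K p.2 :=
  rfl

/-- A nonzero fractional ideal of a number field has a `ℤ`-basis indexed by any type of the size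
of the set of complex embeddings. -/
theorem FractionalIdeal.nonempty_basis {L : Type*} [Field L] [NumberField L] {ι : Type*}
    [Fintype ι] (e : ι ≃ (L →+* ℂ)) (I : FractionalIdeal (𝓞 L)⁰ L) (hI : I ≠ 0) :
    Nonempty (Module.Basis ι ℤ I) := by
  have hcard : Fintype.card
      (Module.Free.ChooseBasisIndex ℤ (Units.mk0 I hI : FractionalIdeal (𝓞 L)⁰ L)) =
        Fintype.card ι := by
    rw [Fintype.card_congr e, Embeddings.card, ← Module.finrank_eq_card_chooseBasisIndex,
      fractionalIdeal_rank, RingOfIntegers.rank]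
  exact ⟨(fractionalIdealBasis L (Units.mk0 I hI : FractionalIdeal (𝓞 L)⁰ L)).reindex
    (Fintype.equivOfCardEq hcard)⟩

/-- for the CM point `z_𝔞 = α/β` of a decomposition `𝔞 = 𝓞_F·α ⊕ f_𝔞·β`
with `Φ(z_𝔞) ∈ ℍ^n`, the fractional `𝓞_K`-ideal `𝓞_F·z_𝔞 + f_𝔞` satisfies
`N_{K/ℚ}(𝓞_F·z_𝔞 + f_𝔞) = N_Φ(y_𝔞) N_{F/ℚ}(f_𝔞) 2^n D_F / √D_K`. -/
theorem stmt7
    (F K : Type) [Field F] [NumberField F] [Field K] [NumberField K] [Algebra F K]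
    (hFreal : ∀ v : InfinitePlace F, v.IsReal)
    (hKcm : ∀ w : InfinitePlace K, w.IsComplex)
    (hdeg : Module.finrank F K = 2)
    (Φ : Finset (K →+* ℂ)) (hΦ : IsCMType K Φ)
    (𝔞 : FractionalIdeal (𝓞 K)⁰ K) (h𝔞 : 𝔞 ≠ 0)
    (f : Ideal (𝓞 F)) (hf : f ≠ 0) (α β : K) (hα : α ≠ 0) (hβ : β ≠ 0)
    (hdec : IsDecomposition F K 𝔞 f α β)
    (hmin : ∀ (f' : Ideal (𝓞 F)) (α' β' : K), f' ≠ 0 → IsDecomposition F K 𝔞 f' α' β' →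
      Ideal.absNorm f ≤ Ideal.absNorm f')
    -- the CM point `Φ(z_𝔞)` lies in `ℍ^n`:
    (hΦz : ∀ φ ∈ Φ, 0 < (φ (α * β⁻¹)).im)
    -- `J` is the fractional `𝓞_K`-ideal `𝓞_F·z_𝔞 + f_𝔞`:
    (J : FractionalIdeal (𝓞 K)⁰ K)
    (hJ : ∀ w : K, w ∈ J ↔ ∃ (u : 𝓞 F) (t : F),
      t ∈ (f : FractionalIdeal (𝓞 F)⁰ F) ∧
      w = algebraMap F K (algebraMap (𝓞 F) F u) * (α * β⁻¹) + algebraMap F K t) :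
    |(FractionalIdeal.absNorm J : ℝ)| =
      (∏ φ ∈ Φ, (φ (α * β⁻¹)).im) * (Ideal.absNorm f : ℝ) *
        (2 : ℝ) ^ (Module.finrank ℚ F) * ((discr F).natAbs : ℝ) /
        Real.sqrt ((discr K).natAbs) := by
  classical
  set z := α * β⁻¹ with hz
  have hreal (φ : K →+* ℂ) (x : F) : (starRingEnd ℂ) (φ (algebraMap F K x)) =
      φ (algebraMap F K x) :=
    RingHom.congr_fun (ComplexEmbedding.isReal_iff.mp (InfinitePlace.isReal_mk_iff.mp
      (hFreal (.mk (φ.comp (algebraMap F K)))))) x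
  let eF : Φ ≃ (F →+* ℂ) := hΦ.restrictEquiv hFreal hdeg
  let eK : Φ ⊕ Φ ≃ (K →+* ℂ) := hΦ.sumEquiv
  have hzF : ∀ x : F, algebraMap F K x ≠ z := by
    intro x hx
    obtain ⟨φ⟩ : Nonempty Φ := eF.nonempty
    have h := hΦz φ.1 φ.2
    rw [← hx, Complex.conj_eq_iff_im.mp (hreal φ.1 x)] at h
    exact h.false
  have hJ' : ∀ w : K, w ∈ J ↔ ∃ u ∈ (1 : FractionalIdeal (𝓞 F)⁰ F),
      ∃ t ∈ (f : FractionalIdeal (𝓞 F)⁰ F),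
        w = algebraMap F K u * z + algebraMap F K t := by
    intro w
    simp [hJ, FractionalIdeal.mem_one_iff]
  obtain ⟨b₁⟩ := FractionalIdeal.nonempty_basis eF (1 : FractionalIdeal (𝓞 F)⁰ F) one_ne_zero
  obtain ⟨b₂⟩ := FractionalIdeal.nonempty_basis eF (f : FractionalIdeal (𝓞 F)⁰ F)
    (FractionalIdeal.coeIdeal_ne_zero.mpr hf)
  let bJ := (b₁.prod b₂).map (FractionalIdeal.prodEquivOfMemIff 1 f J z hzF hJ')
  have hbl (i : Φ) : (bJ (.inl i) : K) = algebraMap F K (b₁ i) * z := by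
    have h₁ := Module.Basis.prod_apply_inl_fst b₁ b₂ i
    have h₂ := Module.Basis.prod_apply_inl_snd b₁ b₂ i
    simp only [bJ, Module.Basis.map_apply, FractionalIdeal.coe_prodEquivOfMemIff]
    rw [h₁, h₂]
    simp
  have hbr (i : Φ) : (bJ (.inr i) : K) = algebraMap F K (b₂ i) := by
    have h₁ := Module.Basis.prod_apply_inr_fst b₁ b₂ i
    have h₂ := Module.Basis.prod_apply_inr_snd b₁ b₂ i
    simp only [bJ, Module.Basis.map_apply, FractionalIdeal.coe_prodEquivOfMemIff]
    rw [h₁, h₂]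
    simp
  let A : Matrix Φ Φ ℂ := .of fun i j => eF j (b₁ i : F)
  let B : Matrix Φ Φ ℂ := .of fun i j => eF j (b₂ i : F)
  have hM : (Matrix.of fun i j => eK j (bJ i : K)) =
      Matrix.fromBlocks (A * Matrix.diagonal fun φ => φ.1 z)
        (A * Matrix.diagonal fun φ => (starRingEnd ℂ) (φ.1 z)) B B := by
    ext (i | i) (j | j) <;>
      simp [A, B, eK, eF, hbl, hbr, hΦ.sumEquiv_inl, hΦ.sumEquiv_inr, hΦ.restrictEquiv_apply,
        hreal]
  have hprod : ‖∏ φ : Φ, (φ.1 z - (starRingEnd ℂ) (φ.1 z))‖ =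
      2 ^ Module.finrank ℚ F * ∏ φ ∈ Φ, (φ z).im := by
    have hc : Module.finrank ℚ F = Fintype.card Φ := by
      rw [Fintype.card_congr eF, Embeddings.card]
    rw [hc, ← Finset.prod_coe_sort Φ fun φ => (φ z).im, norm_prod, ← Finset.card_univ,
      ← Finset.prod_const, ← Finset.prod_mul_distrib]
    refine Finset.prod_congr rfl fun φ _ => ?_
    rw [Complex.sub_conj, norm_mul, Complex.norm_I, mul_one, Complex.norm_real, Real.norm_eq_abs,
      abs_of_pos (mul_pos two_pos (hΦz φ.1 φ.2))]
  have key := norm_det_embeddings J bJ eK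
  rw [hM, Matrix.det_fromBlocks_mul_diagonal, norm_mul, norm_mul, hprod,
    norm_det_embeddings 1 b₁ eF, norm_det_embeddings _ b₂ eF, FractionalIdeal.absNorm_one,
    FractionalIdeal.coeIdeal_absNorm] at key
  have hD : √((discr F).natAbs : ℝ) * √((discr F).natAbs : ℝ) = (discr F).natAbs :=
    Real.mul_self_sqrt (by positivity)
  have hK : 0 < √((discr K).natAbs : ℝ) :=
    Real.sqrt_pos.mpr (by exact_mod_cast Int.natAbs_pos.mpr (discr_ne_zero K))
  have hN : (0 : ℝ) ≤ FractionalIdeal.absNorm J := by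
    exact_mod_cast FractionalIdeal.absNorm_nonneg J
  rw [abs_of_nonneg hN, eq_div_iff hK.ne', ← key]
  push_cast
  linear_combination
    (Ideal.absNorm f * 2 ^ Module.finrank ℚ F * ∏ φ ∈ Φ, (φ z).im : ℝ) * hD
end
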